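/- arXiv:2304.03334 — 2 statements merged into one kernel-verified Lean document; each statement's English description precedes it below -/
import Mathlib

section
/- Let G ⊆ ℂ be a domain and let F ⊆ G be relatively closed in G. Then F is an Arakeljan set in G (in the sense of the G-hole definition) if and only if, in the one-point compactification G* = G ∪ {∞} of G, the subspace G* \ F is connected and G* \ F is locally connected at ∞ (i.e., every neighborhood of ∞ in G* \ F contains a connected neighborhood of ∞ in G* \ F). -/
open Set Metric

/-- A Jordan curve: the image of a continuous injective map from the unit circle into ℂ. -/
def IsJordanCurve (J : Set ℂ) : Prop :=
  ∃ f : ℂ → ℂ, ContinuousOn f (sphere (0 : ℂ) 1) ∧ Set.InjOn f (sphere (0 : ℂ) 1) ∧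
    J = f '' (sphere (0 : ℂ) 1)

/-- The topological boundary of `K` is a finite union of pairwise disjoint Jordan curves. -/
def JordanBoundary (K : Set ℂ) : Prop :=
  ∃ (n : ℕ) (J : Fin n → Set ℂ), (∀ i, IsJordanCurve (J i)) ∧
    (Pairwise fun i j => Disjoint (J i) (J j)) ∧ frontier K = ⋃ i, J i

/-- `g` is a `G`-hole of `F`: a connected component of `G \ F` contained in some
compact subset of `G`. -/
def IsGHole (G F g : Set ℂ) : Prop :=
  (∃ z ∈ G \ F, g = connectedComponentIn (G \ F) z) ∧
  ∃ L : Set ℂ, IsCompact L ∧ L ⊆ G ∧ g ⊆ L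

/-- `F` is an Arakeljan set in `G`: it has no `G`-holes, and for every connected compact
`K ⊆ G` whose boundary is a finite union of pairwise disjoint Jordan curves, the union of
all `G`-holes of `F ∪ K` is contained in some compact subset of `G`. -/
def IsArakeljan (G F : Set ℂ) : Prop :=
  (∀ g : Set ℂ, ¬ IsGHole G F g) ∧
  ∀ K : Set ℂ, IsCompact K → IsConnected K → K ⊆ G → JordanBoundary K →
    ∃ L : Set ℂ, IsCompact L ∧ L ⊆ G ∧ (⋃ g ∈ {g : Set ℂ | IsGHole G (F ∪ K) g}, g) ⊆ L

open OnePoint Filter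

open Topology

theorem mem_nhds_infty_iff_exists_compact {G : Set ℂ} {N : Set (OnePoint ↥G)} :
    N ∈ 𝓝 (∞ : OnePoint ↥G) ↔
      ∞ ∈ N ∧ ∃ L : Set ℂ, IsCompact L ∧ L ⊆ G ∧ ∀ z : ↥G, (z : ℂ) ∉ L → (z : OnePoint ↥G) ∈ N := by
  rw [OnePoint.hasBasis_nhds_infty.mem_iff]
  constructor
  · rintro ⟨C, ⟨-, hC⟩, hN⟩
    refine ⟨hN (Or.inr rfl), Subtype.val '' C, hC.image continuous_subtype_val, by simp, ?_⟩
    intro z hz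
    exact hN (Or.inl ⟨z, fun h => hz ⟨z, h, rfl⟩, rfl⟩)
  · rintro ⟨hi, L, hL, hLG, h⟩
    refine ⟨Subtype.val ⁻¹' L, ⟨hL.isClosed.preimage continuous_subtype_val, ?_⟩, ?_⟩
    · exact Topology.IsInducing.subtypeVal.isCompact_preimage' hL (by simpa using hLG)
    · rintro x (⟨z, hz, rfl⟩ | rfl)
      · exact h z hz
      · exact hi

theorem isPreconnected_insert_infty_image_coe {G C : Set ℂ} (hC : IsPreconnected C) (hCG : C ⊆ G)
    (hunb : ∀ L : Set ℂ, IsCompact L → L ⊆ G → ¬ C ⊆ L) :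
    IsPreconnected (insert ∞ ((fun z : ↥G => (z : OnePoint ↥G)) '' (Subtype.val ⁻¹' C))) := by
  have h1 : IsPreconnected (Subtype.val ⁻¹' C : Set ↥G) := by
    rw [← Topology.IsInducing.subtypeVal.isPreconnected_image]
    rwa [Subtype.image_preimage_coe, inter_eq_self_of_subset_right hCG]
  refine (h1.image _ OnePoint.continuous_coe.continuousOn).subset_closure (subset_insert _ _) ?_
  refine insert_subset ?_ subset_closure
  rw [mem_closure_iff_nhds]
  intro N hN
  obtain ⟨-, L, hL, hLG, h⟩ := mem_nhds_infty_iff_exists_compact.1 hN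
  obtain ⟨z, hzC, hzL⟩ := not_subset.1 (hunb L hL hLG)
  exact ⟨_, h ⟨z, hCG hzC⟩ hzL, ⟨z, hCG hzC⟩, hzC, rfl⟩

theorem isConnected_insert_infty_of_forall {G O : Set ℂ} (hOG : O ⊆ G)
    (h : ∀ z ∈ O, ∃ C ⊆ O, z ∈ C ∧ IsPreconnected C ∧
      ∀ L : Set ℂ, IsCompact L → L ⊆ G → ¬ C ⊆ L) :
    IsConnected (insert ∞ ((fun z : ↥G => (z : OnePoint ↥G)) '' (Subtype.val ⁻¹' O))) := by
  refine ⟨⟨∞, mem_insert _ _⟩, isPreconnected_of_forall ∞ ?_⟩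
  rintro y (rfl | ⟨z, hz, rfl⟩)
  · exact ⟨{∞}, by simp, rfl, rfl, isPreconnected_singleton⟩
  · obtain ⟨C, hCO, hzC, hC, hunb⟩ := h z hz
    exact ⟨_, insert_subset_insert (image_mono (preimage_mono hCO)), mem_insert _ _,
      Or.inr ⟨z, hzC, rfl⟩, isPreconnected_insert_infty_image_coe hC (hCO.trans hOG) hunb⟩

theorem coe_notMem_of_mem_bounded_component {G O L : Set ℂ} (hO : IsOpen O)
    {V : Set (OnePoint ↥G)} (hV : IsPreconnected V) (hiV : ∞ ∈ V)
    (hVO : V ⊆ insert ∞ ((fun z : ↥G => (z : OnePoint ↥G)) '' (Subtype.val ⁻¹' O)))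
    {x : ℂ} (hL : IsCompact L) (hLG : L ⊆ G) (hxL : connectedComponentIn O x ⊆ L)
    (z : ↥G) (hz : (z : ℂ) ∈ connectedComponentIn O x) : (z : OnePoint ↥G) ∉ V := by
  intro hzV
  set g := connectedComponentIn O x with hg
  have hgo : IsOpen g := hO.connectedComponentIn
  have hrest : IsOpen (O \ g) := by
    rw [isOpen_iff_mem_nhds]
    rintro y ⟨hyO, hyg⟩
    refine mem_of_superset (hO.connectedComponentIn.mem_nhds (mem_connectedComponentIn hyO)) ?_
    intro w hw
    refine ⟨connectedComponentIn_subset _ _ hw, fun hwg => hyg ?_⟩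
    rw [hg, connectedComponentIn_eq hwg, ← connectedComponentIn_eq hw]
    exact mem_connectedComponentIn hyO
  let A : Set (OnePoint ↥G) := (fun z : ↥G => (z : OnePoint ↥G)) '' (Subtype.val ⁻¹' g)
  let B : Set (OnePoint ↥G) := ((fun z : ↥G => (z : OnePoint ↥G)) '' (Subtype.val ⁻¹' L))ᶜ ∪
    (fun z : ↥G => (z : OnePoint ↥G)) '' (Subtype.val ⁻¹' (O \ g))
  have hA : IsOpen A := OnePoint.isOpen_image_coe.2 (hgo.preimage continuous_subtype_val)
  have hB : IsOpen B := by
    refine IsOpen.union (OnePoint.isOpen_compl_image_coe.2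
      ⟨hL.isClosed.preimage continuous_subtype_val, ?_⟩)
      (OnePoint.isOpen_image_coe.2 (hrest.preimage continuous_subtype_val))
    exact Topology.IsInducing.subtypeVal.isCompact_preimage' hL (by simpa using hLG)
  have hiB : (∞ : OnePoint ↥G) ∈ B := Or.inl OnePoint.infty_notMem_image_coe
  have hcov : V ⊆ A ∪ B := by
    intro y hy
    rcases hVO hy with rfl | ⟨w, hw, rfl⟩
    · exact Or.inr hiB
    · by_cases hwg : (w : ℂ) ∈ g
      · exact Or.inl ⟨w, hwg, rfl⟩
      · exact Or.inr (Or.inr ⟨w, ⟨hw, hwg⟩, rfl⟩)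
  obtain ⟨y, -, ⟨w, hw, rfl⟩, hyB⟩ := hV A B hA hB hcov ⟨_, hzV, z, hz, rfl⟩ ⟨_, hiV, hiB⟩
  rcases hyB with h | ⟨w', hw', h⟩
  · exact h ⟨w, hxL hw, rfl⟩
  · rw [OnePoint.coe_eq_coe] at h
    exact hw'.2 (h ▸ hw)

theorem isJordanCurve_of_periodic {c : ℝ → ℂ} {T : ℝ} (hT : 0 < T) (hc : Continuous c)
    (hp : Function.Periodic c T) (hinj : InjOn c (Ico 0 T)) : IsJordanCurve (c '' Ico 0 T) := by
  have : Fact (0 < T) := ⟨hT⟩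
  let e : AddCircle T ≃ₜ Circle := AddCircle.homeomorphCircle hT.ne'
  let g : Circle → ℂ := fun z => hp.lift (e.symm z)
  have hlift : Continuous (hp.lift : AddCircle T → ℂ) := continuous_coinduced_dom.2 hc
  have hg : Continuous g := hlift.comp e.symm.continuous
  have hrep : ∀ a : AddCircle T, ∃ x ∈ Ico 0 T, (x : AddCircle T) = a := by
    intro a
    obtain ⟨x, hx, rfl⟩ := AddCircle.coe_image_Ico_eq (p := T) 0 ▸ mem_univ a
    exact ⟨x, by simpa using hx, rfl⟩
  have hginj : Function.Injective g := by
    intro z w hzw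
    obtain ⟨x, hx, hx'⟩ := hrep (e.symm z)
    obtain ⟨y, hy, hy'⟩ := hrep (e.symm w)
    have h : c x = c y := by simpa [g, ← hx', ← hy'] using hzw
    apply e.symm.injective
    rw [← hx', ← hy', hinj hx hy h]
  have hmem (z : sphere (0 : ℂ) 1) : (z : ℂ) ∈ Submonoid.unitSphere ℂ := by
    simp [Submonoid.unitSphere]
  have hval (z : Circle) : Function.extend (Subtype.val : Circle → ℂ) g 0 z = g z :=
    Subtype.val_injective.extend_apply g 0 z
  have hsph (z : ℂ) (hz : z ∈ sphere (0 : ℂ) 1) : ∃ w : Circle, (w : ℂ) = z :=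
    ⟨⟨z, hmem ⟨z, hz⟩⟩, rfl⟩
  refine ⟨Function.extend (Subtype.val : Circle → ℂ) g 0, ?_, ?_, ?_⟩
  · rw [continuousOn_iff_continuous_domRestrict]
    have : (sphere (0 : ℂ) 1).domRestrict (Function.extend (Subtype.val : Circle → ℂ) g 0) =
        fun z : sphere (0 : ℂ) 1 => g ⟨z, hmem z⟩ := by
      ext z
      exact hval ⟨z, hmem z⟩
    rw [this]
    exact hg.comp (continuous_subtype_val.subtype_mk _)
  · intro z hz w hw h
    obtain ⟨z, rfl⟩ := hsph z hz
    obtain ⟨w, rfl⟩ := hsph w hw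
    rw [hval, hval] at h
    rw [hginj h]
  · ext y
    constructor
    · rintro ⟨x, hx, rfl⟩
      refine ⟨e x, mem_sphere_zero_iff_norm.2 (Circle.norm_coe _), ?_⟩
      rw [hval]
      simp [g]
    · rintro ⟨z, hz, rfl⟩
      obtain ⟨z, rfl⟩ := hsph z hz
      obtain ⟨x, hx, hx'⟩ := hrep (e.symm z)
      refine ⟨x, hx, ?_⟩
      rw [hval]
      simp [g, ← hx']

/-- The closed polygon through the points `m (σ ^ k x)`, each edge being traversed in unit time. -/
noncomputable def polygonCurve {X : Type*} (σ : Equiv.Perm X) (m : X → ℂ) (x : X) (τ : ℝ) : ℂ :=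
  AffineMap.lineMap (m ((σ ^ ⌊τ⌋) x)) (m (σ ((σ ^ ⌊τ⌋) x))) (Int.fract τ)

theorem continuous_polygonCurve {X : Type*} (σ : Equiv.Perm X) (m : X → ℂ) (x : X) :
    Continuous (polygonCurve σ m x) := by
  have hfin : LocallyFinite fun n : ℤ => Icc (n : ℝ) (n + 1) := by
    intro y
    refine ⟨Ioo (y - 1) (y + 1), Ioo_mem_nhds (by linarith) (by linarith), ?_⟩
    refine (Set.finite_Icc (⌊y⌋ - 2) (⌊y⌋ + 2)).subset ?_
    rintro n ⟨w, ⟨h1, h2⟩, h3, h4⟩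
    have h5 := Int.floor_le y
    have h6 := Int.lt_floor_add_one y
    constructor
    · have : ((⌊y⌋ - 2 : ℤ) : ℝ) < ((n + 1 : ℤ) : ℝ) := by push_cast; linarith
      have := Int.cast_lt.1 this
      omega
    · have : (n : ℝ) < ((⌊y⌋ + 2 : ℤ) : ℝ) := by push_cast; linarith
      exact (Int.cast_lt.1 this).le
  refine hfin.continuous ?_ (fun n => isClosed_Icc) ?_
  · refine eq_univ_of_forall fun y => mem_iUnion.2 ⟨⌊y⌋, Int.floor_le y, (Int.lt_floor_add_one y).le⟩
  · intro n
    have : ContinuousOn (fun τ : ℝ => AffineMap.lineMap (m ((σ ^ n) x)) (m (σ ((σ ^ n) x))) (τ - n))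
        (Icc (n : ℝ) (n + 1)) := by
      simp only [AffineMap.lineMap_apply_module]
      fun_prop
    refine this.congr fun τ hτ => ?_
    rcases hτ.2.lt_or_eq with h | h
    · have hfl : ⌊τ⌋ = n := Int.floor_eq_iff.2 ⟨hτ.1, h⟩
      simp [polygonCurve, Int.fract, hfl]
    · have hfl : ⌊τ⌋ = n + 1 := by simp [h]
      have hfr : Int.fract τ = 0 := by simp [h]
      have : (σ ^ (n + 1)) x = σ ((σ ^ n) x) := by
        rw [add_comm, zpow_add, zpow_one, Equiv.Perm.mul_apply]
      rw [polygonCurve, hfl, hfr, this]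
      simp [h]

/-- The union of finitely many closed polygons whose edges meet only at consecutive endpoints is a
finite disjoint union of Jordan curves. -/
theorem exists_jordan_decomposition {X : Type*} [Finite X] (σ : Equiv.Perm X) (m : X → ℂ)
    (hinj : ∀ x y : X, ∀ s ∈ Ico (0 : ℝ) 1, ∀ t ∈ Ico (0 : ℝ) 1,
      AffineMap.lineMap (m x) (m (σ x)) s = (AffineMap.lineMap (m y) (m (σ y)) t : ℂ) →
        x = y ∧ s = t) :
    ∃ (n : ℕ) (J : Fin n → Set ℂ), (∀ i, IsJordanCurve (J i)) ∧
      (Pairwise fun i j => Disjoint (J i) (J j)) ∧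
      (⋃ x, (fun t : ℝ => (AffineMap.lineMap (m x) (m (σ x)) t : ℂ)) '' Ico 0 1) = ⋃ i, J i := by
  have hper (x : X) : 0 < Function.minimalPeriod σ x :=
    Function.minimalPeriod_pos_of_mem_periodicPts
      (Function.mem_periodicPts.2 (by
        obtain ⟨k, hk, h⟩ := (isOfFinOrder_of_finite σ).exists_pow_eq_one
        refine ⟨k, hk, ?_⟩
        rw [Function.IsPeriodicPt, Function.IsFixedPt, Equiv.Perm.iterate_eq_pow, h]
        rfl))
  have hzpow (x : X) (k l : ℤ) (h : (σ ^ k) x = (σ ^ l) x) :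
      (Function.minimalPeriod σ x : ℤ) ∣ l - k := by
    have h2 : (σ ^ (l - k)) x = x := by
      rw [sub_eq_neg_add, zpow_add, Equiv.Perm.mul_apply, ← h, ← Equiv.Perm.mul_apply, ← zpow_add]
      simp
    exact (MulAction.zpow_smul_eq_iff_minimalPeriod_dvd (a := σ) (b := x)).1 h2
  let P (x : X) : ℝ := Function.minimalPeriod σ x
  let C (x : X) : Set ℂ := polygonCurve σ m x '' Ico 0 (P x)
  have hjordan (x : X) : IsJordanCurve (C x) := by
    refine isJordanCurve_of_periodic (Nat.cast_pos.2 (hper x)) (continuous_polygonCurve σ m x) ?_ ?_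
    · intro τ
      have h1 : ⌊τ + P x⌋ = ⌊τ⌋ + (Function.minimalPeriod σ x : ℤ) := by simp [P]
      have h2 : Int.fract (τ + P x) = Int.fract τ := by simp [P]
      have h3 : (σ ^ (⌊τ⌋ + (Function.minimalPeriod σ x : ℤ))) x = (σ ^ ⌊τ⌋) x := by
        rw [zpow_add, Equiv.Perm.mul_apply, zpow_natCast, ← Equiv.Perm.iterate_eq_pow,
          Function.iterate_minimalPeriod]
      rw [polygonCurve, polygonCurve, h1, h2, h3]
    · intro τ hτ τ' hτ' h
      obtain ⟨h1, h2⟩ := hinj _ _ _ ⟨Int.fract_nonneg _, Int.fract_lt_one _⟩ _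
        ⟨Int.fract_nonneg _, Int.fract_lt_one _⟩ h
      have h3 := hzpow x _ _ h1
      have h0 : 0 ≤ ⌊τ⌋ := Int.floor_nonneg.2 hτ.1
      have h0' : 0 ≤ ⌊τ'⌋ := Int.floor_nonneg.2 hτ'.1
      have h4 : ⌊τ⌋ < Function.minimalPeriod σ x := Int.floor_lt.2 (by exact_mod_cast hτ.2)
      have h4' : ⌊τ'⌋ < Function.minimalPeriod σ x := Int.floor_lt.2 (by exact_mod_cast hτ'.2)
      have h5 : ⌊τ'⌋ - ⌊τ⌋ = 0 :=
        Int.eq_zero_of_abs_lt_dvd h3 (abs_lt.2 ⟨by linarith, by linarith⟩)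
      rw [← Int.floor_add_fract τ, ← Int.floor_add_fract τ', h2, sub_eq_zero.1 h5]
  have hmem {x : X} {z : ℂ} : z ∈ C x ↔ ∃ k : ℤ, ∃ t ∈ Ico (0 : ℝ) 1,
      (AffineMap.lineMap (m ((σ ^ k) x)) (m (σ ((σ ^ k) x))) t : ℂ) = z := by
    constructor
    · rintro ⟨τ, -, rfl⟩
      exact ⟨⌊τ⌋, Int.fract τ, ⟨Int.fract_nonneg _, Int.fract_lt_one _⟩, rfl⟩
    · rintro ⟨k, t, ht, rfl⟩
      set p : ℤ := ((Function.minimalPeriod σ x : ℕ) : ℤ) with hp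
      have hp0 : 0 < p := Int.natCast_pos.2 (hper x)
      have hfl : ⌊((k % p : ℤ) : ℝ) + t⌋ = k % p := by
        rw [Int.floor_intCast_add, Int.floor_eq_zero_iff.2 ht, add_zero]
      have hfr : Int.fract (((k % p : ℤ) : ℝ) + t) = t := by
        rw [Int.fract_intCast_add, Int.fract_eq_self.2 ht]
      have hk : (σ ^ (k % p)) x = (σ ^ k) x :=
        MulAction.zpow_smul_mod_minimalPeriod (a := σ) (b := x) k
      refine ⟨((k % p : ℤ) : ℝ) + t, ⟨?_, ?_⟩, ?_⟩
      · have : (0 : ℝ) ≤ ((k % p : ℤ) : ℝ) := by exact_mod_cast Int.emod_nonneg k hp0.ne'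
        linarith [ht.1]
      · have : (((k % p : ℤ) : ℝ)) + 1 ≤ (p : ℝ) := by
          exact_mod_cast Int.add_one_le_iff.2 (Int.emod_lt_of_pos k hp0)
        have hP : P x = (p : ℝ) := by simp [P, hp]
        rw [hP]
        linarith [ht.2]
      · rw [polygonCurve, hfl, hfr, hk]
  let Q := Quotient (Equiv.Perm.SameCycle.setoid σ)
  have : Finite Q := Quotient.finite _
  obtain ⟨n, ⟨e⟩⟩ := Finite.exists_equiv_fin Q
  refine ⟨n, fun i => C (e.symm i).out, fun i => hjordan _, ?_, ?_⟩
  · intro i j hij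
    refine Set.disjoint_left.2 fun z hzi hzj => hij ?_
    obtain ⟨k, s, hs, rfl⟩ := hmem.1 hzi
    obtain ⟨l, t, ht, h⟩ := hmem.1 hzj
    have h1 := (hinj _ _ _ ht _ hs h).1
    apply e.symm.injective
    rw [← Quotient.out_eq (e.symm i), ← Quotient.out_eq (e.symm j)]
    refine Quotient.sound ⟨k - l, ?_⟩
    rw [sub_eq_neg_add, zpow_add, Equiv.Perm.mul_apply, ← h1, ← Equiv.Perm.mul_apply, ← zpow_add]
    simp
  · ext z
    simp only [mem_iUnion]
    constructor
    · rintro ⟨x, t, ht, rfl⟩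
      refine ⟨e (Quotient.mk _ x), hmem.2 ?_⟩
      obtain ⟨k, hk⟩ : σ.SameCycle (Quotient.mk (Equiv.Perm.SameCycle.setoid σ) x).out x :=
        Quotient.mk_out (s := Equiv.Perm.SameCycle.setoid σ) x
      refine ⟨k, t, ht, ?_⟩
      rw [Equiv.symm_apply_apply, hk]
    · rintro ⟨i, hi⟩
      obtain ⟨k, t, ht, rfl⟩ := hmem.1 hi
      exact ⟨_, t, ht, rfl⟩

/-- The piecewise linear hat function of the triangular lattice `ℤ + ℤ i`, whose triangles are the
translates of those with vertices `0, 1, 1 + i` and `0, 1 + i, i`. -/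
noncomputable def latticeHat (z : ℂ) : ℝ :=
  max 0 (1 - max |z.re| (max |z.im| |z.re - z.im|))

/-- The lattice point with integer coordinates `p`. -/
noncomputable def latticePt (p : ℤ × ℤ) : ℂ := ⟨p.1, p.2⟩

/-- The linear automorphism of order six permuting the nearest neighbours of the origin. -/
def latticeRot (d : ℤ × ℤ) : ℤ × ℤ := (d.1 - d.2, d.1)

/-- The six nearest neighbours of the origin. -/
def latticeDirs : Finset (ℤ × ℤ) := {(1, 0), (1, 1), (0, 1), (-1, 0), (-1, -1), (0, -1)}

/-- The point with barycentric coordinates `1 - b - c, b, c` in the triangle with vertices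
`p`, `p + d`, `p + latticeRot d`. -/
noncomputable def trianglePt (p d : ℤ × ℤ) (b c : ℝ) : ℂ :=
  latticePt p + b * latticePt d + c * latticePt (latticeRot d)

theorem continuous_latticeHat : Continuous latticeHat := by
  unfold latticeHat
  fun_prop

theorem latticeRot_mem_latticeDirs {d : ℤ × ℤ} (hd : d ∈ latticeDirs) :
    latticeRot d ∈ latticeDirs := by
  simp only [latticeDirs, Finset.mem_insert, Finset.mem_singleton] at hd
  rcases hd with rfl | rfl | rfl | rfl | rfl | rfl <;> decide

theorem ne_zero_of_mem_latticeDirs {d : ℤ × ℤ} (hd : d ∈ latticeDirs) : d ≠ 0 := by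
  rintro rfl
  revert hd
  decide

theorem norm_le_two_of_latticeHat_pos {z : ℂ} (h : 0 < latticeHat z) : ‖z‖ ≤ 2 := by
  have h1 : max |z.re| (max |z.im| |z.re - z.im|) < 1 := by
    by_contra! h'
    rw [latticeHat, max_eq_left (by linarith)] at h
    exact h.false
  simp only [max_lt_iff] at h1
  linarith [Complex.norm_le_abs_re_add_abs_im z]

theorem latticeHat_rot (z : ℂ) : latticeHat ⟨z.re - z.im, z.re⟩ = latticeHat z := by
  have h : |z.re - z.im - z.re| = |z.im| := by rw [sub_sub_cancel_left, abs_neg]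
  simp only [latticeHat, h]
  rw [max_comm |z.re - z.im|, max_assoc]

/-- The hat function at `n` evaluated on a triangle is the barycentric coordinate of `n`. -/
theorem latticeHat_trianglePt {d : ℤ × ℤ} (hd : d ∈ latticeDirs) (p n : ℤ × ℤ) {b c : ℝ}
    (hb : 0 ≤ b) (hc : 0 ≤ c) (hbc : b + c ≤ 1) :
    latticeHat (trianglePt p d b c - latticePt n) =
      (if n = p then 1 - b - c else 0) + (if n = p + d then b else 0) +
        (if n = p + latticeRot d then c else 0) := by
  have base (p n : ℤ × ℤ) : latticeHat (trianglePt p (1, 0) b c - latticePt n) =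
      (if n = p then 1 - b - c else 0) + (if n = p + (1, 0) then b else 0) +
        (if n = p + latticeRot (1, 0) then c else 0) := by
    obtain ⟨n1, n2⟩ := n
    obtain ⟨p1, p2⟩ := p
    obtain ⟨x, rfl⟩ : ∃ x, n1 = p1 + x := ⟨n1 - p1, by ring⟩
    obtain ⟨y, rfl⟩ : ∃ y, n2 = p2 + y := ⟨n2 - p2, by ring⟩
    have hre : (trianglePt (p1, p2) (1, 0) b c - latticePt (p1 + x, p2 + y)).re = b + c - x := by
      simp [trianglePt, latticePt, latticeRot]; ring
    have him : (trianglePt (p1, p2) (1, 0) b c - latticePt (p1 + x, p2 + y)).im = c - y := by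
      simp [trianglePt, latticePt, latticeRot]
    rw [latticeHat, hre, him]
    have hx : (p1 + x, p2 + y) = (p1, p2) ↔ x = 0 ∧ y = 0 := by simp
    have hx1 : (p1 + x, p2 + y) = (p1, p2) + (1, 0) ↔ x = 1 ∧ y = 0 := by simp
    have hx2 : (p1 + x, p2 + y) = (p1, p2) + latticeRot (1, 0) ↔ x = 1 ∧ y = 1 := by
      simp [latticeRot]
    simp only [hx, hx1, hx2]
    by_cases h : (x = 0 ∧ y = 0) ∨ (x = 1 ∧ y = 0) ∨ (x = 1 ∧ y = 1)
    · rcases h with ⟨rfl, rfl⟩ | ⟨rfl, rfl⟩ | ⟨rfl, rfl⟩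
      · have h1 : |b + c - ((0 : ℤ) : ℝ)| = b + c := by simp [abs_of_nonneg (add_nonneg hb hc)]
        have h2 : |c - ((0 : ℤ) : ℝ)| = c := by simp [abs_of_nonneg hc]
        have h3 : |b + c - ((0 : ℤ) : ℝ) - (c - ((0 : ℤ) : ℝ))| = b := by simp [abs_of_nonneg hb]
        rw [h1, h2, h3, max_eq_left (max_le (by linarith) (by linarith)),
          max_eq_right (by linarith)]
        simp; ring
      · have h1 : |b + c - ((1 : ℤ) : ℝ)| = 1 - b - c := by
          rw [abs_of_nonpos (by push_cast; linarith)]; push_cast; ring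
        have h2 : |c - ((0 : ℤ) : ℝ)| = c := by simp [abs_of_nonneg hc]
        have h3 : |b + c - ((1 : ℤ) : ℝ) - (c - ((0 : ℤ) : ℝ))| = 1 - b := by
          rw [abs_of_nonpos (by push_cast; linarith)]; push_cast; ring
        rw [h1, h2, h3, max_eq_right (a := c) (by linarith), max_eq_right (a := 1 - b - c) (by linarith),
          max_eq_right (by linarith)]
        simp
      · have h1 : |b + c - ((1 : ℤ) : ℝ)| = 1 - b - c := by
          rw [abs_of_nonpos (by push_cast; linarith)]; push_cast; ring
        have h2 : |c - ((1 : ℤ) : ℝ)| = 1 - c := by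
          rw [abs_of_nonpos (by push_cast; linarith)]; push_cast; ring
        have h3 : |b + c - ((1 : ℤ) : ℝ) - (c - ((1 : ℤ) : ℝ))| = b := by
          rw [abs_of_nonneg (by push_cast; linarith)]; push_cast; ring
        rw [h1, h2, h3, max_eq_left (a := 1 - c) (by linarith), max_eq_right (a := 1 - b - c) (by linarith),
          max_eq_right (by linarith)]
        simp
    · push Not at h
      rw [if_neg (by tauto), if_neg (by tauto), if_neg (by tauto), max_eq_left]
      · simp
      · rw [sub_nonpos]
        by_contra! hlt
        simp only [max_lt_iff, abs_lt] at hlt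
        obtain ⟨⟨h1, h2⟩, ⟨h3, h4⟩, h5, h6⟩ := hlt
        have hx0 : ((-1 : ℤ) : ℝ) < x := by push_cast; linarith
        have hx3 : (x : ℝ) < ((2 : ℤ) : ℝ) := by push_cast; linarith
        have hy0 : ((-1 : ℤ) : ℝ) < y := by push_cast; linarith
        have hy3 : (y : ℝ) < ((2 : ℤ) : ℝ) := by push_cast; linarith
        have hxy : ((-1 : ℤ) : ℝ) < ((x - y : ℤ) : ℝ) := by push_cast; linarith
        rw [Int.cast_lt] at hx0 hx3 hy0 hy3 hxy
        omega
  have step {d : ℤ × ℤ} (h : ∀ p n : ℤ × ℤ, latticeHat (trianglePt p d b c - latticePt n) =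
      (if n = p then 1 - b - c else 0) + (if n = p + d then b else 0) +
        (if n = p + latticeRot d then c else 0)) (p n : ℤ × ℤ) :
      latticeHat (trianglePt p (latticeRot d) b c - latticePt n) =
      (if n = p then 1 - b - c else 0) + (if n = p + latticeRot d then b else 0) +
        (if n = p + latticeRot (latticeRot d) then c else 0) := by
    have hinj : Function.Injective latticeRot := by
      rintro ⟨a, a'⟩ ⟨e, e'⟩ h
      simp only [latticeRot, Prod.mk.injEq] at h ⊢
      omega
    have hadd (u v : ℤ × ℤ) : latticeRot (u + v) = latticeRot u + latticeRot v := by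
      ext <;> simp [latticeRot]; ring
    obtain ⟨n, rfl⟩ : ∃ m, n = latticeRot m := ⟨(n.2, n.2 - n.1), by simp [latticeRot]⟩
    obtain ⟨p, rfl⟩ : ∃ m, p = latticeRot m := ⟨(p.2, p.2 - p.1), by simp [latticeRot]⟩
    simp only [← hadd, hinj.eq_iff]
    rw [← h p n, ← latticeHat_rot (trianglePt p d b c - latticePt n)]
    congr 1
    apply Complex.ext <;> simp [trianglePt, latticePt, latticeRot]; ring
  simp only [latticeDirs, Finset.mem_insert, Finset.mem_singleton] at hd
  rcases hd with rfl | rfl | rfl | rfl | rfl | rfl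
  · exact base p n
  · exact step base p n
  · exact step (step base) p n
  · exact step (step (step base)) p n
  · exact step (step (step (step base))) p n
  · exact step (step (step (step (step base)))) p n

theorem exists_trianglePt_eq (z : ℂ) : ∃ p, ∃ d ∈ latticeDirs, ∃ b c : ℝ,
    0 ≤ b ∧ 0 ≤ c ∧ b + c ≤ 1 ∧ z = trianglePt p d b c := by
  have hu := Int.fract_nonneg z.re
  have hu' := (Int.fract_lt_one z.re).le
  have hv := Int.fract_nonneg z.im
  have hv' := (Int.fract_lt_one z.im).le
  have hre := Int.floor_add_fract z.re
  have him := Int.floor_add_fract z.im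
  rcases le_total (Int.fract z.im) (Int.fract z.re) with h | h
  · refine ⟨(⌊z.re⌋, ⌊z.im⌋), (1, 0), by decide, Int.fract z.re - Int.fract z.im, Int.fract z.im,
      by linarith, hv, by linarith, ?_⟩
    apply Complex.ext <;> simp [trianglePt, latticePt, latticeRot]; linarith
  · refine ⟨(⌊z.re⌋, ⌊z.im⌋), (1, 1), by decide, Int.fract z.re, Int.fract z.im - Int.fract z.re,
      hu, by linarith, by linarith, ?_⟩
    apply Complex.ext <;> simp [trianglePt, latticePt, latticeRot]

/-- Cyclic relabelling of the vertices of a triangle. -/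
theorem trianglePt_rotate (p d : ℤ × ℤ) (b c : ℝ) :
    trianglePt p d b c = trianglePt (p + d) (latticeRot (latticeRot d)) c (1 - b - c) := by
  apply Complex.ext <;> simp [trianglePt, latticePt, latticeRot] <;> ring

theorem add_latticeRot_latticeRot (p d : ℤ × ℤ) :
    p + d + latticeRot (latticeRot d) = p + latticeRot d := by
  ext <;> simp [latticeRot]; ring

theorem add_latticeRot_latticeRot_latticeRot (p d : ℤ × ℤ) :
    p + d + latticeRot (latticeRot (latticeRot d)) = p := by
  ext <;> simp [latticeRot]; ring

/-- The piecewise linear interpolation of the indicator function of `A`. -/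
noncomputable def latticeField (A : Finset (ℤ × ℤ)) (z : ℂ) : ℝ :=
  ∑ n ∈ A, latticeHat (z - latticePt n)

theorem continuous_latticeField (A : Finset (ℤ × ℤ)) : Continuous (latticeField A) :=
  continuous_finsetSum _ fun _ _ => continuous_latticeHat.comp (continuous_id.sub continuous_const)

theorem latticeField_trianglePt (A : Finset (ℤ × ℤ)) {d : ℤ × ℤ} (hd : d ∈ latticeDirs) (p : ℤ × ℤ)
    {b c : ℝ} (hb : 0 ≤ b) (hc : 0 ≤ c) (hbc : b + c ≤ 1) :
    latticeField A (trianglePt p d b c) =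
      (if p ∈ A then 1 - b - c else 0) + (if p + d ∈ A then b else 0) +
        (if p + latticeRot d ∈ A then c else 0) := by
  simp only [latticeField, latticeHat_trianglePt hd _ _ hb hc hbc, Finset.sum_add_distrib,
    Finset.sum_ite_eq']

theorem exists_trianglePt_eq_of_latticeHat_pos {z : ℂ} {n : ℤ × ℤ}
    (h : 0 < latticeHat (z - latticePt n)) : ∃ d ∈ latticeDirs, ∃ b c : ℝ,
    0 ≤ b ∧ 0 ≤ c ∧ b + c ≤ 1 ∧ z = trianglePt n d b c := by
  obtain ⟨p, d, hd, b, c, hb, hc, hbc, rfl⟩ := exists_trianglePt_eq z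
  have hd' := latticeRot_mem_latticeDirs (latticeRot_mem_latticeDirs hd)
  by_cases h1 : n = p
  · exact ⟨d, hd, b, c, hb, hc, hbc, by rw [h1]⟩
  by_cases h2 : n = p + d
  · exact ⟨_, hd', c, 1 - b - c, hc, by linarith, by linarith, by rw [h2, trianglePt_rotate]⟩
  by_cases h3 : n = p + latticeRot d
  · refine ⟨_, latticeRot_mem_latticeDirs (latticeRot_mem_latticeDirs hd'), 1 - b - c, b,
      by linarith, hb, by linarith, ?_⟩
    rw [h3, trianglePt_rotate, trianglePt_rotate, add_latticeRot_latticeRot]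
    ring_nf
  · simp [latticeHat_trianglePt hd _ _ hb hc hbc, h1, h2, h3] at h

theorem latticeField_lineMap (A : Finset (ℤ × ℤ)) {z : ℂ} {n : ℤ × ℤ}
    (h : 0 < latticeHat (z - latticePt n)) {t : ℝ} (ht : t ∈ Icc (0 : ℝ) 1) :
    latticeField A (AffineMap.lineMap z (latticePt n) t) =
      (1 - t) * latticeField A z + if n ∈ A then t else 0 := by
  obtain ⟨d, hd, b, c, hb, hc, hbc, rfl⟩ := exists_trianglePt_eq_of_latticeHat_pos h
  have h1 : AffineMap.lineMap (trianglePt n d b c) (latticePt n) t =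
      trianglePt n d ((1 - t) * b) ((1 - t) * c) := by
    rw [AffineMap.lineMap_apply_module]
    simp only [trianglePt, Complex.real_smul]
    push_cast
    ring
  have ht0 : 0 ≤ 1 - t := by linarith [ht.2]
  rw [h1, latticeField_trianglePt A hd n (mul_nonneg ht0 hb) (mul_nonneg ht0 hc)
    (by nlinarith [ht.1]), latticeField_trianglePt A hd n hb hc hbc]
  split_ifs <;> ring

theorem latticeField_eq_one {A : Finset (ℤ × ℤ)} {z : ℂ}
    (h : ∀ n, 0 < latticeHat (z - latticePt n) → n ∈ A) : latticeField A z = 1 := by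
  obtain ⟨p, d, hd, b, c, hb, hc, hbc, rfl⟩ := exists_trianglePt_eq z
  rw [latticeField_trianglePt A hd p hb hc hbc]
  have key (n : ℤ × ℤ) (hn : n ∉ A) : (if n = p then 1 - b - c else 0) +
      (if n = p + d then b else 0) + (if n = p + latticeRot d then c else 0) ≤ 0 := by
    rw [← latticeHat_trianglePt hd p n hb hc hbc]
    exact not_lt.1 fun h' => hn (h n h')
  have k1 (n : ℤ × ℤ) : 0 ≤ if n = p then 1 - b - c else 0 := by
    split_ifs <;> linarith
  have k2 (n : ℤ × ℤ) : 0 ≤ if n = p + d then b else 0 := by split_ifs <;> linarith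
  have k3 (n : ℤ × ℤ) : 0 ≤ if n = p + latticeRot d then c else 0 := by split_ifs <;> linarith
  have e1 : (if p ∈ A then 1 - b - c else 0) = 1 - b - c := by
    split_ifs with hn
    · rfl
    · have := key _ hn
      rw [if_pos rfl] at this
      linarith [k2 p, k3 p]
  have e2 : (if p + d ∈ A then b else 0) = b := by
    split_ifs with hn
    · rfl
    · have := key _ hn
      rw [if_pos (c := p + d = p + d) rfl] at this
      linarith [k1 (p + d), k3 (p + d)]
  have e3 : (if p + latticeRot d ∈ A then c else 0) = c := by
    split_ifs with hn
    · rfl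
    · have := key _ hn
      rw [if_pos (c := p + latticeRot d = p + latticeRot d) rfl] at this
      linarith [k1 (p + latticeRot d), k2 (p + latticeRot d)]
  rw [e1, e2, e3]
  ring

theorem exists_mem_of_latticeField_pos {A : Finset (ℤ × ℤ)} {z : ℂ} (h : 0 < latticeField A z) :
    ∃ n ∈ A, 0 < latticeHat (z - latticePt n) := by
  by_contra! h'
  exact h.not_ge (Finset.sum_nonpos h')

theorem frontier_latticeField (A : Finset (ℤ × ℤ)) :
    frontier {z | 1 / 2 ≤ latticeField A z} = {z | latticeField A z = 1 / 2} := by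
  refine Subset.antisymm ?_ ?_
  · intro z hz
    exact (frontier_le_subset_eq continuous_const (continuous_latticeField A) hz).symm
  · intro z (hz : latticeField A z = 1 / 2)
    obtain ⟨n, hn, hnA⟩ : ∃ n, 0 < latticeHat (z - latticePt n) ∧ n ∉ A := by
      by_contra! h
      rw [latticeField_eq_one h] at hz
      norm_num at hz
    rw [frontier_eq_closure_inter_closure]
    refine ⟨subset_closure hz.ge, ?_⟩
    have htend : Tendsto (fun t : ℝ => (AffineMap.lineMap z (latticePt n) t : ℂ)) (𝓝[>] 0) (𝓝 z) := by
      have : Continuous fun t : ℝ => (AffineMap.lineMap z (latticePt n) t : ℂ) :=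
        AffineMap.lineMap_continuous
      simpa using (this.tendsto 0).mono_left nhdsWithin_le_nhds
    refine mem_closure_of_tendsto htend ?_
    filter_upwards [Ioo_mem_nhdsGT (zero_lt_one (α := ℝ))] with t ht
    rw [mem_compl_iff, mem_ofPred_eq, latticeField_lineMap A hn ⟨ht.1.le, ht.2.le⟩, hz, if_neg hnA]
    linarith [ht.1]

/-- Two points on boundary edges of `A` with the same barycentric coordinates coincide. -/
theorem eq_of_barycentric_eq {X : Type*} [DecidableEq X] {A : Finset X} {p q r p' q' r' : X}
    {b b' t t' : ℝ} (ht : t ∈ Ico (0 : ℝ) 1) (ht' : t' ∈ Ico (0 : ℝ) 1)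
    (hp : p ∈ A) (hq : q ∉ A) (hp' : p' ∈ A) (hq' : q' ∉ A) (hpr : r ≠ p) (hqr : r ≠ q)
    (hpr' : r' ≠ p') (hqr' : r' ≠ q')
    (h₁ : ¬ (q = q' ∧ p = r' ∧ p' = r)) (h₂ : ¬ (p = p' ∧ q = r' ∧ q' = r))
    (hb : b = if r ∈ A then 1 / 2 else (1 - t) / 2)
    (hb' : b' = if r' ∈ A then 1 / 2 else (1 - t') / 2)
    (H : ∀ n, (if n = p then 1 - b - t / 2 else 0) + (if n = q then b else 0) +
      (if n = r then t / 2 else 0) = (if n = p' then 1 - b' - t' / 2 else 0) +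
      (if n = q' then b' else 0) + (if n = r' then t' / 2 else 0)) :
    p = p' ∧ q = q' ∧ t = t' := by
  obtain ⟨ht0, ht1⟩ := ht
  obtain ⟨ht0', ht1'⟩ := ht'
  have hpq : p ≠ q := by grind
  have hpq' : p' ≠ q' := by grind
  have H1 := H p
  have H2 := H q
  have H3 := H r
  have H1' := H p'
  have H2' := H q'
  have H3' := H r'
  clear H
  by_cases hr : r ∈ A <;> by_cases hr' : r' ∈ A
  · rw [if_pos hr] at hb
    rw [if_pos hr'] at hb'
    subst hb hb'
    grind
  · rw [if_pos hr] at hb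
    rw [if_neg hr'] at hb'
    subst hb hb'
    grind
  · rw [if_neg hr] at hb
    rw [if_pos hr'] at hb'
    subst hb hb'
    grind
  · rw [if_neg hr] at hb
    rw [if_neg hr'] at hb'
    subst hb hb'
    grind

/-- The oriented boundary edges of `A`: pairs `(p, d)` such that `p ∈ A` and its neighbour `p + d`
is not in `A`. -/
abbrev BoundaryEdge (A : Finset (ℤ × ℤ)) : Type :=
  {s : (ℤ × ℤ) × (ℤ × ℤ) // s.1 ∈ A ∧ s.1 + s.2 ∉ A ∧ s.2 ∈ latticeDirs}

namespace BoundaryEdge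

variable {A : Finset (ℤ × ℤ)}

instance : Finite (BoundaryEdge A) := by
  refine Set.Finite.to_subtype ((A ×ˢ latticeDirs).finite_toSet.subset ?_)
  intro s hs
  simpa using ⟨hs.1, hs.2.2⟩

theorem sub_latticeRot_mem_latticeDirs {d : ℤ × ℤ} (hd : d ∈ latticeDirs) :
    d - latticeRot d ∈ latticeDirs := by
  simp only [latticeDirs, Finset.mem_insert, Finset.mem_singleton] at hd
  rcases hd with rfl | rfl | rfl | rfl | rfl | rfl <;> decide

/-- The boundary edge following `s` along the boundary of `A`. -/
def next (s : BoundaryEdge A) : BoundaryEdge A :=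
  if h : s.1.1 + latticeRot s.1.2 ∈ A then
    ⟨(s.1.1 + latticeRot s.1.2, s.1.2 - latticeRot s.1.2), h, by simpa using s.2.2.1,
      sub_latticeRot_mem_latticeDirs s.2.2.2⟩
  else ⟨(s.1.1, latticeRot s.1.2), s.2.1, h, latticeRot_mem_latticeDirs s.2.2.2⟩

theorem next_injective : Function.Injective (next : BoundaryEdge A → BoundaryEdge A) := by
  have mixed (s s' : BoundaryEdge A) (h : s.1.1 + latticeRot s.1.2 = s'.1.1)
      (h' : s.1.2 - latticeRot s.1.2 = latticeRot s'.1.2) : False := by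
    refine s'.2.2.1 ?_
    have : s'.1.1 + s'.1.2 = s.1.1 := by
      simp only [latticeRot, Prod.ext_iff, Prod.fst_add, Prod.snd_add, Prod.fst_sub,
        Prod.snd_sub] at h h' ⊢
      omega
    rw [this]
    exact s.2.1
  intro s s' h
  by_cases h1 : s.1.1 + latticeRot s.1.2 ∈ A <;> by_cases h2 : s'.1.1 + latticeRot s'.1.2 ∈ A
  · simp only [next, dif_pos h1, dif_pos h2, Subtype.mk.injEq, Prod.mk.injEq] at h
    apply Subtype.ext
    simp only [latticeRot, Prod.ext_iff, Prod.fst_add, Prod.snd_add, Prod.fst_sub,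
      Prod.snd_sub] at h ⊢
    omega
  · simp only [next, dif_pos h1, dif_neg h2, Subtype.mk.injEq, Prod.mk.injEq] at h
    exact (mixed s s' h.1 h.2).elim
  · simp only [next, dif_neg h1, dif_pos h2, Subtype.mk.injEq, Prod.mk.injEq] at h
    exact (mixed s' s h.1.symm h.2.symm).elim
  · simp only [next, dif_neg h1, dif_neg h2, Subtype.mk.injEq, Prod.mk.injEq] at h
    apply Subtype.ext
    simp only [latticeRot, Prod.ext_iff] at h ⊢
    omega

/-- The permutation of the boundary edges of `A` sending each one to the following one. -/
noncomputable def nextPerm (A : Finset (ℤ × ℤ)) : Equiv.Perm (BoundaryEdge A) :=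
  Equiv.ofBijective next (Finite.injective_iff_bijective.1 next_injective)

/-- The midpoint of a boundary edge. -/
noncomputable def midpt (s : BoundaryEdge A) : ℂ := trianglePt s.1.1 s.1.2 (1 / 2) 0

theorem lineMap_midpt (s : BoundaryEdge A) (t : ℝ) :
    AffineMap.lineMap s.midpt (nextPerm A s).midpt t =
      trianglePt s.1.1 s.1.2
        (if s.1.1 + latticeRot s.1.2 ∈ A then 1 / 2 else (1 - t) / 2) (t / 2) := by
  rw [AffineMap.lineMap_apply_module]
  simp only [nextPerm, Equiv.ofBijective_apply, next]
  split_ifs with h <;>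
    · simp only [midpt]
      apply Complex.ext <;> simp [trianglePt, latticePt, latticeRot] <;> ring

theorem latticeField_lineMap_midpt (s : BoundaryEdge A) {t : ℝ} (ht : t ∈ Icc (0 : ℝ) 1) :
    latticeField A (AffineMap.lineMap s.midpt (nextPerm A s).midpt t) = 1 / 2 := by
  obtain ⟨ht0, ht1⟩ := ht
  rw [lineMap_midpt, latticeField_trianglePt A s.2.2.2 _ (by split_ifs <;> linarith) (by linarith)
    (by split_ifs <;> linarith), if_pos s.2.1, if_neg s.2.2.1]
  split_ifs <;> ring

theorem exists_lineMap_midpt_eq_of_trianglePt {p d : ℤ × ℤ} {b c : ℝ} (hd : d ∈ latticeDirs)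
    (hb : 0 ≤ b) (hc : 0 ≤ c) (hbc : b + c ≤ 1) (hp : p ∈ A) (hpd : p + d ∉ A)
    (h : latticeField A (trianglePt p d b c) = 1 / 2) :
    ∃ s : BoundaryEdge A, ∃ t ∈ Ico (0 : ℝ) 1,
      AffineMap.lineMap s.midpt (nextPerm A s).midpt t = trianglePt p d b c := by
  let s : BoundaryEdge A := ⟨(p, d), hp, hpd, hd⟩
  rw [latticeField_trianglePt A hd p hb hc hbc, if_pos hp, if_neg hpd] at h
  have hc1 : 2 * c ≤ 1 := by
    split_ifs at h <;> linarith
  have hz : AffineMap.lineMap s.midpt (nextPerm A s).midpt (2 * c) = trianglePt p d b c := by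
    rw [lineMap_midpt]
    have : (if s.1.1 + latticeRot s.1.2 ∈ A then 1 / 2 else (1 - 2 * c) / 2) = b := by
      simp only [s]
      split_ifs at h ⊢ <;> linarith
    rw [this, mul_div_cancel_left₀ c two_ne_zero]
  rcases hc1.lt_or_eq with h1 | h1
  · exact ⟨s, 2 * c, ⟨by linarith, h1⟩, hz⟩
  · refine ⟨nextPerm A s, 0, ⟨le_rfl, one_pos⟩, ?_⟩
    rw [h1, AffineMap.lineMap_apply_one] at hz
    rw [AffineMap.lineMap_apply_zero, hz]

theorem exists_lineMap_midpt_eq {z : ℂ} (h : latticeField A z = 1 / 2) :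
    ∃ s : BoundaryEdge A, ∃ t ∈ Ico (0 : ℝ) 1,
      AffineMap.lineMap s.midpt (nextPerm A s).midpt t = z := by
  obtain ⟨p, d, hd, b, c, hb, hc, hbc, rfl⟩ := exists_trianglePt_eq z
  have hd2 := latticeRot_mem_latticeDirs (latticeRot_mem_latticeDirs hd)
  have hd4 := latticeRot_mem_latticeDirs (latticeRot_mem_latticeDirs hd2)
  by_cases h1 : p ∈ A ∧ p + d ∉ A
  · exact exists_lineMap_midpt_eq_of_trianglePt hd hb hc hbc h1.1 h1.2 h
  by_cases h2 : p + d ∈ A ∧ p + latticeRot d ∉ A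
  · rw [trianglePt_rotate] at h ⊢
    exact exists_lineMap_midpt_eq_of_trianglePt hd2 hc (by linarith) (by linarith) h2.1
      (by rw [add_latticeRot_latticeRot]; exact h2.2) h
  by_cases h3 : p + latticeRot d ∈ A ∧ p ∉ A
  · rw [trianglePt_rotate, trianglePt_rotate] at h ⊢
    refine exists_lineMap_midpt_eq_of_trianglePt hd4 (by linarith) (by linarith) (by linarith)
      ?_ ?_ h
    · rw [add_latticeRot_latticeRot]
      exact h3.1
    · rw [add_latticeRot_latticeRot, add_latticeRot_latticeRot_latticeRot]
      exact h3.2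
  · rw [latticeField_trianglePt A hd p hb hc hbc] at h
    exfalso
    by_cases hp : p ∈ A
    · have hq : p + d ∈ A := by tauto
      have hr : p + latticeRot d ∈ A := by tauto
      rw [if_pos hp, if_pos hq, if_pos hr] at h
      linarith
    · have hr : p + latticeRot d ∉ A := by tauto
      have hq : p + d ∉ A := by tauto
      rw [if_neg hp, if_neg hq, if_neg hr] at h
      norm_num at h

theorem lineMap_midpt_injective (s s' : BoundaryEdge A) (t : ℝ) (ht : t ∈ Ico (0 : ℝ) 1) (t' : ℝ)
    (ht' : t' ∈ Ico (0 : ℝ) 1)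
    (h : AffineMap.lineMap s.midpt (nextPerm A s).midpt t =
      (AffineMap.lineMap s'.midpt (nextPerm A s').midpt t' : ℂ)) : s = s' ∧ t = t' := by
  rw [lineMap_midpt, lineMap_midpt] at h
  have rot_ne (p : ℤ × ℤ) {d : ℤ × ℤ} (hd : d ∈ latticeDirs) :
      p + latticeRot d ≠ p ∧ p + latticeRot d ≠ p + d := by
    have := ne_zero_of_mem_latticeDirs hd
    simp only [latticeRot, Ne, Prod.ext_iff, Prod.fst_add, Prod.snd_add, Prod.fst_zero,
      Prod.snd_zero] at this ⊢
    omega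
  obtain ⟨⟨p, d⟩, hp, hq, hd⟩ := s
  obtain ⟨⟨p', d'⟩, hp', hq', hd'⟩ := s'
  obtain ⟨rfl, hdd, rfl⟩ : p = p' ∧ p + d = p' + d' ∧ t = t' := by
    refine eq_of_barycentric_eq ht ht' hp hq hp' hq' (rot_ne p hd).1 (rot_ne p hd).2
      (rot_ne p' hd').1 (rot_ne p' hd').2 ?_ ?_ rfl rfl fun n => ?_
    · have := ne_zero_of_mem_latticeDirs hd
      simp only [latticeRot, Ne, Prod.ext_iff, Prod.fst_add, Prod.snd_add, Prod.fst_zero,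
        Prod.snd_zero] at this ⊢
      omega
    · have := ne_zero_of_mem_latticeDirs hd
      simp only [latticeRot, Ne, Prod.ext_iff, Prod.fst_add, Prod.snd_add, Prod.fst_zero,
        Prod.snd_zero] at this ⊢
      omega
    · obtain ⟨ht0, ht1⟩ := ht
      obtain ⟨ht0', ht1'⟩ := ht'
      rw [← latticeHat_trianglePt hd _ _ (by split_ifs <;> linarith) (by linarith)
        (by split_ifs <;> linarith), ← latticeHat_trianglePt hd' _ _ (by split_ifs <;> linarith)
        (by linarith) (by split_ifs <;> linarith), h]
  obtain rfl := add_left_cancel hdd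
  exact ⟨rfl, rfl⟩

end BoundaryEdge

theorem jordanBoundary_latticeField (A : Finset (ℤ × ℤ)) :
    JordanBoundary {z | 1 / 2 ≤ latticeField A z} := by
  obtain ⟨n, J, hJ, hdisj, hU⟩ := exists_jordan_decomposition (BoundaryEdge.nextPerm A)
    BoundaryEdge.midpt BoundaryEdge.lineMap_midpt_injective
  refine ⟨n, J, hJ, hdisj, ?_⟩
  rw [frontier_latticeField, ← hU]
  ext z
  simp only [mem_ofPred_eq, mem_iUnion, mem_image]
  constructor
  · exact BoundaryEdge.exists_lineMap_midpt_eq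
  · rintro ⟨s, t, ht, rfl⟩
    exact s.latticeField_lineMap_midpt ⟨ht.1, ht.2.le⟩

theorem JordanBoundary.image_homeomorph {K : Set ℂ} (hK : JordanBoundary K) (e : ℂ ≃ₜ ℂ) :
    JordanBoundary (e '' K) := by
  obtain ⟨n, J, hJ, hdisj, hU⟩ := hK
  refine ⟨n, fun i => e '' J i, fun i => ?_, fun i j hij => ?_, ?_⟩
  · obtain ⟨f, hf, hinj, hJi⟩ := hJ i
    exact ⟨e ∘ f, e.continuous.comp_continuousOn hf, e.injective.comp_injOn hinj, by
      simp only [hJi, image_comp]⟩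
  · exact (disjoint_image_iff e.injective).2 (hdisj hij)
  · rw [← e.image_frontier, hU, image_iUnion]

theorem finite_latticeHat_pos {K : Set ℂ} (hK : Bornology.IsBounded K) :
    {n | ∃ y ∈ K, 0 < latticeHat (y - latticePt n)}.Finite := by
  obtain ⟨R, hR⟩ := hK.exists_norm_le
  refine ((Set.finite_Icc (-⌈R + 2⌉) ⌈R + 2⌉).prod (Set.finite_Icc (-⌈R + 2⌉) ⌈R + 2⌉)).subset ?_
  rintro n ⟨y, hy, hn⟩
  have h : ‖latticePt n‖ ≤ ⌈R + 2⌉ := by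
    have h1 := norm_le_two_of_latticeHat_pos hn
    have h2 := norm_sub_norm_le (latticePt n) y
    rw [norm_sub_rev] at h2
    linarith [hR y hy, Int.le_ceil (R + 2)]
  have h1 : |(n.1 : ℝ)| ≤ ⌈R + 2⌉ := (Complex.abs_re_le_norm (latticePt n)).trans h
  have h2 : |(n.2 : ℝ)| ≤ ⌈R + 2⌉ := (Complex.abs_im_le_norm (latticePt n)).trans h
  exact ⟨abs_le.1 (by exact_mod_cast h1), abs_le.1 (by exact_mod_cast h2)⟩

/-- A continuum has a neighbourhood of bounded width that is a continuum with Jordan boundary. -/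
theorem exists_jordanBoundary_dist_le_four {K : Set ℂ} (hK : IsCompact K) (hKc : IsConnected K) :
    ∃ L, IsCompact L ∧ IsConnected L ∧ K ⊆ L ∧ JordanBoundary L ∧ ∀ z ∈ L, ∃ y ∈ K, dist z y ≤ 4 := by
  let A : Finset (ℤ × ℤ) := (finite_latticeHat_pos hK.isBounded).toFinset
  have hA {n : ℤ × ℤ} : n ∈ A ↔ ∃ y ∈ K, 0 < latticeHat (y - latticePt n) := by simp [A]
  have hKA {y : ℂ} (hy : y ∈ K) : latticeField A y = 1 :=
    latticeField_eq_one fun n hn => hA.2 ⟨y, hy, hn⟩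
  have hKL : K ⊆ {z | 1 / 2 ≤ latticeField A z} := fun y hy => by
    rw [mem_ofPred_eq, hKA hy]
    norm_num
  have hnear (z : ℂ) (hz : z ∈ {z | 1 / 2 ≤ latticeField A z}) : ∃ n ∈ A, ∃ y ∈ K,
      0 < latticeHat (z - latticePt n) ∧ 0 < latticeHat (y - latticePt n) := by
    obtain ⟨n, hn, hzn⟩ := exists_mem_of_latticeField_pos (one_half_pos.trans_le hz)
    obtain ⟨y, hy, hyn⟩ := hA.1 hn
    exact ⟨n, hn, y, hy, hzn, hyn⟩
  have hdist (z : ℂ) (hz : z ∈ {z | 1 / 2 ≤ latticeField A z}) : ∃ y ∈ K, dist z y ≤ 4 := by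
    obtain ⟨n, -, y, hy, hzn, hyn⟩ := hnear z hz
    refine ⟨y, hy, ?_⟩
    have h1 := norm_le_two_of_latticeHat_pos hzn
    have h2 := norm_le_two_of_latticeHat_pos hyn
    rw [← dist_eq_norm] at h1 h2
    linarith [dist_triangle_right z y (latticePt n)]
  have hseg {z : ℂ} {n : ℤ × ℤ} (hn : n ∈ A) (hzn : 0 < latticeHat (z - latticePt n))
      (hz : z ∈ {z | 1 / 2 ≤ latticeField A z}) :
      segment ℝ z (latticePt n) ⊆ {z | 1 / 2 ≤ latticeField A z} := by
    rw [segment_eq_image_lineMap]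
    rintro - ⟨t, ht, rfl⟩
    rw [mem_ofPred_eq] at hz ⊢
    rw [latticeField_lineMap A hzn ht, if_pos hn]
    nlinarith [ht.1, ht.2]
  obtain ⟨x₀, hx₀⟩ := hKc.nonempty
  refine ⟨{z | 1 / 2 ≤ latticeField A z}, ?_, ⟨⟨x₀, hKL hx₀⟩, ?_⟩, hKL,
    jordanBoundary_latticeField A, hdist⟩
  · refine Metric.isCompact_of_isClosed_isBounded
      (isClosed_le continuous_const (continuous_latticeField A)) ?_
    refine hK.isBounded.cthickening (δ := 4) |>.subset fun z hz => ?_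
    obtain ⟨y, hy, hzy⟩ := hdist z hz
    exact mem_cthickening_of_dist_le z y 4 K hy hzy
  · refine isPreconnected_of_forall x₀ fun z hz => ?_
    obtain ⟨n, hn, y, hy, hzn, hyn⟩ := hnear z hz
    refine ⟨(segment ℝ z (latticePt n) ∪ segment ℝ y (latticePt n)) ∪ K,
      union_subset (union_subset (hseg hn hzn hz) (hseg hn hyn (hKL hy))) hKL, Or.inr hx₀,
      Or.inl (Or.inl (left_mem_segment ℝ _ _)), ?_⟩
    refine IsPreconnected.union y (Or.inr (left_mem_segment ℝ _ _)) hy ?_ hKc.isPreconnected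
    exact IsPreconnected.union _ (right_mem_segment ℝ _ _) (right_mem_segment ℝ _ _)
      (convex_segment _ _).isPreconnected (convex_segment _ _).isPreconnected

theorem exists_compact_connected_superset {G K₀ : Set ℂ} (hGopen : IsOpen G) (hGconn : IsConnected G)
    (hK₀ : IsCompact K₀) (hK₀G : K₀ ⊆ G) :
    ∃ K : Set ℂ, IsCompact K ∧ IsConnected K ∧ K₀ ⊆ K ∧ K ⊆ G := by
  obtain ⟨x₀, hx₀⟩ := hGconn.nonempty
  choose! r hr hrG using fun x (hx : x ∈ G) => nhds_basis_closedBall.mem_iff.1 (hGopen.mem_nhds hx)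
  obtain ⟨T, hTK, hT⟩ := hK₀.elim_nhds_subcover (fun x => closedBall x (r x))
    fun x hx => closedBall_mem_nhds x (hr x (hK₀G hx))
  have hpath := (hGopen.isConnected_iff_isPathConnected.1 hGconn).joinedIn x₀ hx₀
  choose! P hP hPc hPG using fun x (hx : x ∈ G) => show ∃ P : Set ℂ, IsCompact P ∧
      (IsPreconnected P ∧ x₀ ∈ P ∧ x ∈ P) ∧ P ⊆ G from
    ⟨range (hpath x hx).somePath, isCompact_range (hpath x hx).somePath.continuous,
      ⟨isPreconnected_range (hpath x hx).somePath.continuous, ⟨0, by simp⟩, ⟨1, by simp⟩⟩,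
      range_subset_iff.2 (hpath x hx).somePath_mem⟩
  have hTG (x : ℂ) (hx : x ∈ T) : x ∈ G := hK₀G (hTK x hx)
  refine ⟨{x₀} ∪ ⋃ x ∈ T, (P x ∪ closedBall x (r x)), ?_, ⟨⟨x₀, Or.inl rfl⟩, ?_⟩, ?_, ?_⟩
  · exact isCompact_singleton.union <| T.isCompact_biUnion fun x hx =>
      (hP x (hTG x hx)).union (isCompact_closedBall _ _)
  · refine isPreconnected_of_forall x₀ ?_
    rintro y (rfl | hy)
    · exact ⟨{y}, subset_union_left, rfl, rfl, isPreconnected_singleton⟩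
    · obtain ⟨x, hx, hy⟩ := mem_iUnion₂.1 hy
      obtain ⟨hc, h0, h1⟩ := hPc x (hTG x hx)
      refine ⟨P x ∪ closedBall x (r x), fun z hz => Or.inr (mem_biUnion hx hz), Or.inl h0, hy, ?_⟩
      exact hc.union x h1 (mem_closedBall_self (hr x (hTG x hx)).le)
        (convex_closedBall x (r x)).isPreconnected
  · exact fun y hy => Or.inr (biUnion_mono (fun _ h => h) (fun _ _ => subset_union_right) (hT hy))
  · refine union_subset (singleton_subset_iff.2 hx₀) (iUnion₂_subset fun x hx => ?_)
    exact union_subset (hPG x (hTG x hx)) (hrG x (hTG x hx))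

theorem exists_jordanBoundary_superset {G K₀ : Set ℂ} (hGopen : IsOpen G) (hGconn : IsConnected G)
    (hK₀ : IsCompact K₀) (hK₀G : K₀ ⊆ G) :
    ∃ K : Set ℂ, IsCompact K ∧ IsConnected K ∧ K₀ ⊆ K ∧ K ⊆ G ∧ JordanBoundary K := by
  obtain ⟨K₁, hK₁, hK₁c, hK₀₁, hK₁G⟩ :=
    exists_compact_connected_superset hGopen hGconn hK₀ hK₀G
  obtain ⟨δ, hδ, hδG⟩ := hK₁.exists_cthickening_subset_open hGopen hK₁G
  have hne : ((δ / 4 : ℝ) : ℂ) ≠ 0 := by exact_mod_cast (by positivity : δ / 4 ≠ 0)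
  let e : ℂ ≃ₜ ℂ := Homeomorph.mulLeft₀ _ hne
  obtain ⟨L, hL, hLc, hKL, hLJ, hdist⟩ := exists_jordanBoundary_dist_le_four
    (hK₁.image e.symm.continuous) (hK₁c.image e.symm e.symm.continuous.continuousOn)
  refine ⟨e '' L, hL.image e.continuous, hLc.image e e.continuous.continuousOn, ?_, ?_,
    hLJ.image_homeomorph e⟩
  · intro z hz
    exact ⟨e.symm z, hKL ⟨z, hK₀₁ hz, rfl⟩, e.apply_symm_apply z⟩
  · rintro - ⟨z, hz, rfl⟩
    obtain ⟨-, ⟨y, hy, rfl⟩, hzy⟩ := hdist z hz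
    refine hδG (mem_cthickening_of_dist_le _ y _ _ hy ?_)
    calc dist (e z) y = dist (e z) (e (e.symm y)) := by rw [e.apply_symm_apply]
      _ = δ / 4 * dist z (e.symm y) := by
        simp only [e, Homeomorph.coe_mulLeft₀, dist_eq_norm, ← mul_sub, norm_mul]
        rw [Complex.norm_of_nonneg (by positivity)]
      _ ≤ δ := by nlinarith

/-- `F` is an Arakeljan set in `G` (in the `G`-hole sense) iff in the
one-point compactification `G* = OnePoint ↥G`, the subspace `S = G* \ F` is connected and
locally connected at `∞` (every neighborhood of `∞` in `S` contains a connected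
neighborhood of `∞` in `S`). -/
theorem isArakeljan_iff_onePoint
    (G F : Set ℂ) (hGopen : IsOpen G) (hGconn : IsConnected G)
    (hFG : F ⊆ G) (hFclosed : closure F ∩ G ⊆ F)
    (S : Set (OnePoint ↥G))
    (hS : S = {OnePoint.infty} ∪ (fun z : ↥G => (z : OnePoint ↥G)) '' {z : ↥G | (z : ℂ) ∉ F}) :
    IsArakeljan G F ↔
      (IsConnected S ∧
        ∀ U ∈ nhdsWithin OnePoint.infty S,
          ∃ V ∈ nhdsWithin OnePoint.infty S, V ⊆ U ∩ S ∧ IsConnected V) := by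
  have hS' : S = insert ∞ ((fun z : ↥G => (z : OnePoint ↥G)) '' (Subtype.val ⁻¹' (G \ F))) := by
    rw [hS, singleton_union]
    congr 2
    ext z
    simp
  have hO : IsOpen (G \ F) := by
    have : G \ F = G \ closure F := by
      ext z
      exact ⟨fun h => ⟨h.1, fun hz => h.2 (hFclosed ⟨hz, h.1⟩)⟩,
        fun h => ⟨h.1, fun hz => h.2 (subset_closure hz)⟩⟩
    rw [this]
    exact hGopen.sdiff isClosed_closure
  have hiS : (∞ : OnePoint ↥G) ∈ S := hS' ▸ mem_insert _ _
  have hole_of_bounded {E L : Set ℂ} {z : ℂ} (hz : z ∈ G \ E) (hL : IsCompact L) (hLG : L ⊆ G)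
      (h : connectedComponentIn (G \ E) z ⊆ L) : IsGHole G E (connectedComponentIn (G \ E) z) :=
    ⟨⟨z, hz, rfl⟩, L, hL, hLG, h⟩
  constructor
  · rintro ⟨hno, hK⟩
    refine ⟨?_, ?_⟩
    · rw [hS']
      refine isConnected_insert_infty_of_forall sdiff_subset fun z hz => ?_
      exact ⟨_, connectedComponentIn_subset _ _, mem_connectedComponentIn hz,
        isPreconnected_connectedComponentIn,
        fun L hL hLG h => hno _ (hole_of_bounded hz hL hLG h)⟩
    · intro U hU
      obtain ⟨N, hN, hNU⟩ := mem_nhdsWithin_iff_exists_mem_nhds_inter.1 hU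
      obtain ⟨hiN, K₀, hK₀, hK₀G, hK₀N⟩ := mem_nhds_infty_iff_exists_compact.1 hN
      obtain ⟨K, hKc, hKconn, hK₀K, hKG, hKJ⟩ :=
        exists_jordanBoundary_superset hGopen hGconn hK₀ hK₀G
      obtain ⟨L, hL, hLG, hLholes⟩ := hK K hKc hKconn hKG hKJ
      set E := F ∪ K with hE
      let O' : Set ℂ := {z | z ∈ G \ E ∧ ¬ IsGHole G E (connectedComponentIn (G \ E) z)}
      have hO'O : O' ⊆ G \ F := fun z hz => ⟨hz.1.1, fun h => hz.1.2 (Or.inl h)⟩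
      refine ⟨insert ∞ ((fun z : ↥G => (z : OnePoint ↥G)) '' (Subtype.val ⁻¹' O')), ?_, ?_, ?_⟩
      · rw [mem_nhdsWithin_iff_exists_mem_nhds_inter]
        refine ⟨insert ∞ ((fun z : ↥G => (z : OnePoint ↥G)) '' (Subtype.val ⁻¹' (K ∪ L)ᶜ)),
          mem_nhds_infty_iff_exists_compact.2 ⟨mem_insert _ _, K ∪ L, hKc.union hL,
            union_subset hKG hLG, fun z hz => Or.inr ⟨z, hz, rfl⟩⟩, ?_⟩
        rintro y ⟨rfl | ⟨z, hz, rfl⟩, hyS⟩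
        · exact mem_insert _ _
        · rw [hS'] at hyS
          rcases hyS with h | ⟨w, hw, h⟩
          · exact absurd h (OnePoint.coe_ne_infty z)
          · obtain rfl := OnePoint.coe_injective h
            have hwE : (w : ℂ) ∈ G \ E :=
              ⟨w.2, fun h => h.elim hw.2 fun h => hz (Or.inl h)⟩
            refine Or.inr ⟨w, ⟨hwE, fun hhole => hz (Or.inr (hLholes ?_))⟩, rfl⟩
            exact mem_biUnion (show _ ∈ {g | IsGHole G E g} from hhole)
              (mem_connectedComponentIn hwE)
      · rintro y (rfl | ⟨z, hz, rfl⟩)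
        · exact ⟨hNU ⟨hiN, hiS⟩, hiS⟩
        · have hzS : (z : OnePoint ↥G) ∈ S := hS' ▸ Or.inr ⟨z, hO'O hz, rfl⟩
          exact ⟨hNU ⟨hK₀N z fun h => hz.1.2 (Or.inr (hK₀K h)), hzS⟩, hzS⟩
      · refine isConnected_insert_infty_of_forall (hO'O.trans sdiff_subset) fun z hz => ?_
        refine ⟨_, ?_, mem_connectedComponentIn hz.1, isPreconnected_connectedComponentIn,
          fun L hL hLG h => hz.2 (hole_of_bounded hz.1 hL hLG h)⟩
        intro w hw
        refine ⟨connectedComponentIn_subset _ _ hw, ?_⟩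
        rw [← connectedComponentIn_eq hw]
        exact hz.2
  · rintro ⟨hSconn, hloc⟩
    refine ⟨?_, ?_⟩
    · rintro g ⟨⟨z, hz, rfl⟩, L, hL, hLG, hgL⟩
      refine coe_notMem_of_mem_bounded_component hO hSconn.isPreconnected hiS hS'.le hL hLG hgL
        ⟨z, hz.1⟩ (mem_connectedComponentIn hz) ?_
      rw [hS']
      exact Or.inr ⟨⟨z, hz.1⟩, hz, rfl⟩
    · intro K hKc _ hKG _
      have hOK : IsOpen (G \ (F ∪ K)) := by
        rw [← sdiff_sdiff]
        exact hO.sdiff hKc.isClosed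
      obtain ⟨V, hV, hVS, hVconn⟩ := hloc
        (insert ∞ ((fun z : ↥G => (z : OnePoint ↥G)) '' (Subtype.val ⁻¹' Kᶜ)))
        (mem_nhdsWithin_of_mem_nhds (mem_nhds_infty_iff_exists_compact.2
          ⟨mem_insert _ _, K, hKc, hKG, fun z hz => Or.inr ⟨z, hz, rfl⟩⟩))
      obtain ⟨N, hN, hNV⟩ := mem_nhdsWithin_iff_exists_mem_nhds_inter.1 hV
      obtain ⟨hiN, L, hL, hLG, hLN⟩ := mem_nhds_infty_iff_exists_compact.1 hN
      refine ⟨L, hL, hLG, iUnion₂_subset ?_⟩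
      rintro g ⟨⟨x, hx, rfl⟩, L', hL', hLG', hgL'⟩ z hz
      have hzG := connectedComponentIn_subset _ _ hz
      by_contra hzL
      refine coe_notMem_of_mem_bounded_component hOK hVconn.isPreconnected (hNV ⟨hiN, hiS⟩) ?_
        hL' hLG' hgL' ⟨z, hzG.1⟩ hz (hNV ⟨hLN _ hzL, ?_⟩)
      · intro y hy
        obtain ⟨rfl | ⟨w, hw, rfl⟩, hyS⟩ := hVS hy
        · exact mem_insert _ _
        · rw [hS'] at hyS
          rcases hyS with h | ⟨w', hw', h⟩
          · exact absurd h (OnePoint.coe_ne_infty w)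
          · obtain rfl := OnePoint.coe_injective h
            exact Or.inr ⟨_, ⟨w'.2, fun h => h.elim hw'.2 hw⟩, rfl⟩
      · rw [hS']
        exact Or.inr ⟨⟨z, hzG.1⟩, ⟨hzG.1, fun h => hzG.2 (Or.inl h)⟩, rfl⟩
end

section
/- Let G ⊆ ℂ be a simply connected domain and let (Fₙ)ₙ₌₁^∞ be a locally finite family of pairwise disjoint Arakeljan sets in G (each Fₙ relatively closed in G, and every point of G has a neighborhood meeting only finitely many Fₙ). Then the union ⋃ₙ Fₙ is also an Arakeljan set in G. -/
open Set Metric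

/-- The function `z ↦ z - p` has a continuous logarithm on `X`. -/
def HasContinuousLog (p : ℂ) (X : Set ℂ) : Prop :=
  ∃ f : ℂ → ℂ, ContinuousOn f X ∧ ∀ z ∈ X, Complex.exp (f z) = z - p

namespace HasContinuousLog

variable {p q : ℂ} {X Y : Set ℂ}

theorem mono (h : HasContinuousLog p Y) (hXY : X ⊆ Y) : HasContinuousLog p X := by
  obtain ⟨f, hf, hfe⟩ := h
  exact ⟨f, hf.mono hXY, fun z hz => hfe z (hXY hz)⟩

theorem notMem (h : HasContinuousLog p X) : p ∉ X := by
  obtain ⟨f, -, hfe⟩ := h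
  intro hp
  exact Complex.exp_ne_zero (f p) (by rw [hfe p hp, sub_self])

theorem empty : HasContinuousLog p ∅ :=
  ⟨fun _ => 0, continuousOn_empty _, by simp⟩

theorem of_dist_lt (h : HasContinuousLog p X) (hq : ∀ z ∈ X, dist p q < dist z p) :
    HasContinuousLog q X := by
  obtain ⟨f, hf, hfe⟩ := h
  have hne : ∀ z ∈ X, z - p ≠ 0 := fun z hz => by
    rw [← hfe z hz]; exact Complex.exp_ne_zero _
  have hslit : ∀ z ∈ X, 1 + (p - q) / (z - p) ∈ Complex.slitPlane := by
    intro z hz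
    apply Complex.mem_slitPlane_of_norm_lt_one
    rw [norm_div, div_lt_one (norm_pos_iff.2 (hne z hz)), ← dist_eq_norm, ← dist_eq_norm]
    exact hq z hz
  refine ⟨fun z => f z + Complex.log (1 + (p - q) / (z - p)), ?_, ?_⟩
  · refine hf.add (ContinuousOn.clog ?_ hslit)
    exact continuousOn_const.add
      (continuousOn_const.div (continuousOn_id.sub continuousOn_const) hne)
  · intro z hz
    rw [Complex.exp_add, hfe z hz, Complex.exp_log (Complex.slitPlane_ne_zero (hslit z hz))]
    have := hne z hz
    field_simp
    ring

/-- For closed `X`, having a continuous logarithm is locally constant in `p ∉ X`. -/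
theorem eventually_iff (hX : IsClosed X) (hp : p ∉ X) :
    ∀ᶠ q in nhds p, HasContinuousLog q X ↔ HasContinuousLog p X := by
  obtain ⟨r, hr, hball⟩ := Metric.isOpen_iff.1 hX.isOpen_compl p hp
  have hfar : ∀ z ∈ X, r ≤ dist z p := fun z hz => by
    by_contra! h
    exact hball h hz
  filter_upwards [ball_mem_nhds p (half_pos hr)] with q hq
  rw [mem_ball] at hq
  constructor
  · intro h
    refine h.of_dist_lt fun z hz => ?_
    have := hfar z hz
    have := dist_triangle z q p
    linarith
  · intro h
    refine h.of_dist_lt fun z hz => ?_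
    have := hfar z hz
    rw [dist_comm]
    linarith

theorem isOpen_setOf (hX : IsClosed X) : IsOpen {p | HasContinuousLog p X} := by
  rw [isOpen_iff_mem_nhds]
  intro p hp
  filter_upwards [eventually_iff hX (HasContinuousLog.notMem hp)] with q hq
  exact hq.2 hp

/-- Having a continuous logarithm propagates along preconnected sets avoiding `X`. -/
theorem of_isPreconnected {c : Set ℂ} (hX : IsClosed X) (hc : IsPreconnected c)
    (hcX : Disjoint c X) (hq : q ∈ c) (h : HasContinuousLog q X) (hp : p ∈ c) :
    HasContinuousLog p X := by
  have hsub : c ⊆ {p | HasContinuousLog p X} := by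
    refine hc.subset_of_closure_inter_subset (isOpen_setOf hX) ⟨q, hq, h⟩ ?_
    rintro x ⟨hx, hxc⟩
    have hev := eventually_iff hX (Set.disjoint_left.1 hcX hxc)
    obtain ⟨y, hy, hyl⟩ := mem_closure_iff_nhds.1 hx _ hev
    exact hy.1 hyl
  exact hsub hp

/-- Continuous logarithms glue along a preconnected intersection. -/
theorem union (hX : IsClosed X) (hY : IsClosed Y) (hXY : IsPreconnected (X ∩ Y))
    (h₁ : HasContinuousLog p X) (h₂ : HasContinuousLog p Y) : HasContinuousLog p (X ∪ Y) := by
  classical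
  obtain ⟨f, hf, hfe⟩ := h₁
  obtain ⟨g, hg, hge⟩ := h₂
  obtain ⟨k, hk, hfg⟩ : ∃ k : ℂ, Complex.exp k = 1 ∧ ∀ z ∈ X ∩ Y, f z = g z + k := by
    rcases (X ∩ Y).eq_empty_or_nonempty with h | ⟨w, hw⟩
    · exact ⟨0, Complex.exp_zero, by simp [h]⟩
    · have hexp : ∀ z ∈ X ∩ Y, Complex.exp (f z - g z) = 1 := by
        intro z hz
        rw [Complex.exp_sub, hfe z hz.1, hge z hz.2, div_self]
        rw [← hfe z hz.1]
        exact Complex.exp_ne_zero _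
      refine ⟨f w - g w, hexp w hw, fun z hz => ?_⟩
      have hcont : ContinuousOn (fun z => f z - g z) (X ∩ Y) :=
        (hf.mono inter_subset_left).sub (hg.mono inter_subset_right)
      have := Complex.isCoveringMap_exp.constOn_of_comp hXY hcont
        (fun a ha b hb => Subtype.ext ((hexp a ha).trans (hexp b hb).symm)) hz hw
      rw [← this]
      ring
  refine ⟨X.piecewise f (fun z => g z + k), ?_, ?_⟩
  · refine ContinuousOn.union_of_isClosed ?_ ?_ hX hY
    · exact hf.congr fun z hz => Set.piecewise_eq_of_mem _ _ _ hz
    · have hgk : ContinuousOn (fun z => g z + k) Y := hg.add continuousOn_const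
      refine hgk.congr fun z hz => ?_
      by_cases hzX : z ∈ X
      · rw [Set.piecewise_eq_of_mem _ _ _ hzX, hfg z ⟨hzX, hz⟩]
      · rw [Set.piecewise_eq_of_notMem _ _ _ hzX]
  · intro z hz
    by_cases hzX : z ∈ X
    · rw [Set.piecewise_eq_of_mem _ _ _ hzX, hfe z hzX]
    · rw [Set.piecewise_eq_of_notMem _ _ _ hzX, Complex.exp_add, hk, mul_one,
        hge z (hz.resolve_left hzX)]

theorem of_norm_lt (h : ∀ z ∈ X, ‖z‖ < ‖p‖) : HasContinuousLog p X := by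
  rcases X.eq_empty_or_nonempty with rfl | ⟨w, hw⟩
  · exact empty
  have hp : p ≠ 0 := norm_pos_iff.1 ((norm_nonneg w).trans_lt (h w hw))
  have hslit : ∀ z ∈ X, 1 + -z / p ∈ Complex.slitPlane := by
    intro z hz
    apply Complex.mem_slitPlane_of_norm_lt_one
    rw [norm_div, norm_neg, div_lt_one (norm_pos_iff.2 hp)]
    exact h z hz
  refine ⟨fun z => Complex.log (-p) + Complex.log (1 + -z / p), ?_, fun z hz => ?_⟩
  · refine continuousOn_const.add (ContinuousOn.clog ?_ hslit)
    fun_prop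
  · rw [Complex.exp_add, Complex.exp_log (neg_ne_zero.2 hp),
      Complex.exp_log (Complex.slitPlane_ne_zero (hslit z hz))]
    field_simp
    ring

/-- In a simply connected domain `G` containing a compact set `X`, the function `z ↦ z - p` has a
continuous logarithm on `X` for all `p` outside a suitable compact subset of `G`. -/
theorem exists_isCompact {G : Set ℂ} (hG : IsOpen G) (hGsc : IsSimplyConnected G)
    (hX : IsCompact X) (hXG : X ⊆ G) :
    ∃ L, IsCompact L ∧ L ⊆ G ∧ ∀ p ∉ L, HasContinuousLog p X := by
  obtain ⟨R, hR⟩ := hX.isBounded.subset_closedBall 0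
  refine ⟨closedBall 0 R \ {p | HasContinuousLog p X},
    (isCompact_closedBall 0 R).diff (isOpen_setOf hX.isClosed), ?_, ?_⟩
  · rintro p ⟨-, hp⟩
    by_contra hpG
    obtain ⟨f, hf, hfe⟩ := Complex.exists_continuousOn_eqOn_exp_comp hGsc hG
      (g := fun z => z - p) (by fun_prop) (by
        rintro ⟨z, hz, hzp⟩
        exact hpG (sub_eq_zero.1 hzp ▸ hz))
    exact hp ⟨f, hf.mono hXG, fun z hz => hfe (hXG hz)⟩
  · intro p hp
    by_contra hlog
    refine hlog (of_norm_lt fun z hz => ?_)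
    have hz' : ‖z‖ ≤ R := by simpa using hR hz
    have hp' : R < ‖p‖ := by
      by_contra! hle
      exact hp ⟨by simpa using hle, hlog⟩
    exact hz'.trans_lt hp'

/-- A point of a bounded set `h` is separated from infinity by `frontier h`. -/
theorem not_frontier {h : Set ℂ} (hbdd : Bornology.IsBounded h) (hp : p ∈ h) :
    ¬ HasContinuousLog p (frontier h) := by
  classical
  rintro ⟨f, hf, hfe⟩
  obtain ⟨F, hF⟩ := ContinuousMap.exists_restrict_eq (isClosed_frontier (s := h))
    ⟨(frontier h).domRestrict f, continuousOn_iff_continuous_domRestrict.1 hf⟩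
  have hFf : ∀ z ∈ frontier h, F z = f z := fun z hz => DFunLike.congr_fun hF ⟨z, hz⟩
  set H : ℂ → ℂ := (closure h).piecewise (fun z => Complex.exp (F z)) (fun z => z - p) with hH
  have hHc : Continuous H := by
    refine continuous_piecewise (fun z hz => ?_) (by fun_prop) (by fun_prop)
    have hz' := frontier_closure_subset hz
    rw [hFf z hz', hfe z hz']
  have hH0 : ∀ z, H z ≠ 0 := by
    intro z
    by_cases hz : z ∈ closure h
    · rw [hH, Set.piecewise_eq_of_mem _ _ _ hz]
      exact Complex.exp_ne_zero _
    · rw [hH, Set.piecewise_eq_of_notMem _ _ _ hz]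
      intro h0
      exact hz (sub_eq_zero.1 h0 ▸ subset_closure hp)
  have huniv : IsSimplyConnected (univ : Set ℂ) := by
    have := (convex_univ (𝕜 := ℝ) (E := ℂ)).contractibleSpace univ_nonempty
    exact SimplyConnectedSpace.ofContractible _
  obtain ⟨g, hg, hge⟩ := Complex.exists_continuousOn_eqOn_exp_comp huniv isOpen_univ (g := H) hHc.continuousOn (by rintro ⟨z, -, hz⟩; exact hH0 z hz)
  rw [continuousOn_univ] at hg
  obtain ⟨R, hR⟩ := hbdd.closure.subset_ball p
  have hR0 : 0 < R := by simpa using hR (subset_closure hp)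
  have hHR : ∀ t : ℝ, H (circleMap p R t) = R * Complex.exp (t * Complex.I) := by
    intro t
    have hz : circleMap p R t ∉ closure h := by
      intro hz
      have h1 := hR hz
      have h2 := circleMap_mem_sphere p hR0.le t
      rw [mem_ball] at h1
      rw [mem_sphere] at h2
      exact h1.ne h2
    rw [hH, Set.piecewise_eq_of_notMem _ _ _ hz, circleMap_sub_center, circleMap_zero]
  have hconst := Complex.isCoveringMap_exp.const_of_comp
    (g := fun t : ℝ => g (circleMap p R t) - t * Complex.I) (by fun_prop) (fun s t => by
      have key : ∀ t : ℝ, Complex.exp (g (circleMap p R t) - t * Complex.I) = R := by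
        intro t
        have := hge (Set.mem_univ (circleMap p R t))
        rw [Function.comp_apply, hHR] at this
        rw [Complex.exp_sub, this, mul_div_cancel_right₀ _ (Complex.exp_ne_zero _)]
      exact Subtype.ext ((key s).trans (key t).symm)) 0 (2 * Real.pi)
  have hper : circleMap p R (2 * Real.pi) = circleMap p R 0 := by
    simpa using periodic_circleMap p R 0
  simp only [hper, Complex.ofReal_zero, zero_mul, sub_zero] at hconst
  have hzero : ((2 * Real.pi : ℝ) : ℂ) * Complex.I = 0 := sub_eq_self.1 hconst.symm
  simp [Real.pi_ne_zero] at hzero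

end HasContinuousLog

theorem IsCompact.inter_of_closure_inter_subset {C E G : Set ℂ} (hC : IsCompact C) (hCG : C ⊆ G)
    (hE : closure E ∩ G ⊆ E) : IsCompact (C ∩ E) := by
  have : C ∩ E = C ∩ closure E := by
    refine Subset.antisymm (inter_subset_inter_right _ subset_closure) ?_
    rintro z ⟨hz, hzE⟩
    exact ⟨hz, hE ⟨hzE, hCG hz⟩⟩
  rw [this]
  exact hC.inter_right isClosed_closure

theorem isOpen_diff_of_closure_inter_subset {E G : Set ℂ} (hG : IsOpen G)
    (hE : closure E ∩ G ⊆ E) : IsOpen (G \ E) := by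
  have : G \ E = G \ closure E := by
    refine Subset.antisymm ?_ (sdiff_subset_sdiff_right subset_closure)
    rintro z ⟨hz, hzE⟩
    exact ⟨hz, fun h => hzE (hE ⟨h, hz⟩)⟩
  rw [this]
  exact hG.sdiff isClosed_closure

/-- The frontier of a `G`-hole of a relatively closed set lies in that set. -/
theorem IsGHole.frontier_subset {G E h : Set ℂ} (hG : IsOpen G) (hE : closure E ∩ G ⊆ E)
    (hh : IsGHole G E h) : frontier h ⊆ E := by
  obtain ⟨⟨p, -, rfl⟩, L, hL, hLG, hhL⟩ := hh
  have hopen := isOpen_diff_of_closure_inter_subset hG hE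
  intro x hx
  by_contra hxE
  have hxG : x ∈ G \ E :=
    ⟨hLG (closure_minimal hhL hL.isClosed (frontier_subset_closure hx)), hxE⟩
  obtain ⟨y, hyx, hyp⟩ := mem_closure_iff_nhds.1 (frontier_subset_closure hx) _
    (hopen.connectedComponentIn.mem_nhds (mem_connectedComponentIn hxG))
  have heq : connectedComponentIn (G \ E) x = connectedComponentIn (G \ E) p :=
    (connectedComponentIn_eq hyx).trans (connectedComponentIn_eq hyp).symm
  rw [hopen.connectedComponentIn.frontier_eq] at hx
  exact hx.2 (heq ▸ mem_connectedComponentIn hxG)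

/-- In a simply connected domain, a point of `G \ E` lying in no `G`-hole of `E` is not separated
from the boundary of `G` by any compact subset of `E`. -/
theorem HasContinuousLog.of_not_isGHole {G E X : Set ℂ} {p : ℂ} (hG : IsOpen G)
    (hGsc : IsSimplyConnected G) (hX : IsCompact X) (hXE : X ⊆ E) (hXG : X ⊆ G)
    (hp : p ∈ G \ E) (hhole : ¬ IsGHole G E (connectedComponentIn (G \ E) p)) :
    HasContinuousLog p X := by
  obtain ⟨L, hL, hLG, hlog⟩ := HasContinuousLog.exists_isCompact hG hGsc hX hXG
  have hnot : ¬ connectedComponentIn (G \ E) p ⊆ L :=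
    fun h => hhole ⟨⟨p, hp, rfl⟩, L, hL, hLG, h⟩
  obtain ⟨q, hq, hqL⟩ := Set.not_subset.1 hnot
  refine HasContinuousLog.of_isPreconnected hX.isClosed isPreconnected_connectedComponentIn ?_ hq
    (hlog q hqL) (mem_connectedComponentIn hp)
  rw [Set.disjoint_left]
  intro z hz hzX
  exact (connectedComponentIn_subset _ _ hz).2 (hXE hzX)

/-- Continuous logarithms on sets `E n ∪ K`, with the `E n` pairwise disjoint and `K` preconnected,
glue to a continuous logarithm on the union. -/
theorem HasContinuousLog.biUnion_union {ι : Type*} {p : ℂ} {K : Set ℂ} {E : ι → Set ℂ}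
    (hK : IsClosed K) (hKc : IsPreconnected K) (hE : ∀ n, IsClosed (E n))
    (hdisj : Pairwise fun m n => Disjoint (E m) (E n)) (hpK : HasContinuousLog p K)
    (hlog : ∀ n, HasContinuousLog p (E n ∪ K)) (S : Finset ι) :
    HasContinuousLog p ((⋃ n ∈ S, E n) ∪ K) := by
  classical
  induction S using Finset.induction_on with
  | empty => simpa using hpK
  | insert a S ha ih =>
    have hinter : (E a ∪ K) ∩ ((⋃ n ∈ S, E n) ∪ K) = K := by
      rw [← Set.inter_union_distrib_right]
      have : E a ∩ ⋃ n ∈ S, E n = ∅ := by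
        rw [← Set.disjoint_iff_inter_eq_empty, Set.disjoint_iUnion₂_right]
        intro n hn
        exact hdisj (by rintro rfl; exact ha hn)
      rw [this, Set.empty_union]
    have := (hlog a).union ((hE a).union hK)
      ((S.finite_toSet.isClosed_biUnion fun n _ => hE n).union hK) (by
        simpa only [Finset.mem_coe, hinter] using hKc) ih
    rw [Finset.set_biUnion_insert, Set.union_assoc]
    refine this.mono ?_
    intro z
    simp only [Set.mem_union]
    tauto

section LocallyFinite

variable {G : Set ℂ} {Fn : ℕ → Set ℂ}

theorem finite_inter_nonempty_of_isCompact
    (hlocfin : ∀ z ∈ G, ∃ U ∈ nhds z, {n : ℕ | (Fn n ∩ U).Nonempty}.Finite)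
    {C : Set ℂ} (hC : IsCompact C) (hCG : C ⊆ G) : {n : ℕ | (Fn n ∩ C).Nonempty}.Finite := by
  refine hC.induction_on (p := fun C => {n : ℕ | (Fn n ∩ C).Nonempty}.Finite) (by simp) ?_ ?_ ?_
  · intro s t hst ht
    exact ht.subset fun n hn => hn.mono (inter_subset_inter_right _ hst)
  · intro s t hs ht
    refine (hs.union ht).subset fun n hn => ?_
    rwa [mem_ofPred_eq, inter_union_distrib_left, union_nonempty] at hn
  · intro z hz
    obtain ⟨U, hU, hfin⟩ := hlocfin z (hCG hz)
    exact ⟨U, mem_nhdsWithin_of_mem_nhds hU, hfin⟩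

theorem closure_iUnion_inter_subset (hFclosed : ∀ n, closure (Fn n) ∩ G ⊆ Fn n)
    (hlocfin : ∀ z ∈ G, ∃ U ∈ nhds z, {n : ℕ | (Fn n ∩ U).Nonempty}.Finite) :
    closure (⋃ n, Fn n) ∩ G ⊆ ⋃ n, Fn n := by
  rintro z ⟨hz, hzG⟩
  obtain ⟨U, hU, hfin⟩ := hlocfin z hzG
  have hz' : z ∈ closure (⋃ n ∈ {n : ℕ | (Fn n ∩ U).Nonempty}, Fn n) := by
    rw [mem_closure_iff_nhds] at hz ⊢
    intro V hV
    obtain ⟨y, ⟨hyV, hyU⟩, hy⟩ := hz _ (Filter.inter_mem hV hU)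
    obtain ⟨n, hn⟩ := mem_iUnion.1 hy
    exact ⟨y, hyV, mem_iUnion₂.2 ⟨n, ⟨y, hn, hyU⟩, hn⟩⟩
  rw [hfin.closure_biUnion] at hz'
  obtain ⟨n, -, hn⟩ := mem_iUnion₂.1 hz'
  exact mem_iUnion.2 ⟨n, hFclosed n ⟨hn, hzG⟩⟩

/-- A Janiszewski-type principle: if `z ↦ z - p` has a continuous logarithm on `K` and on `C ∪ K`
for every compact `C` contained in a single `Fn n`, then `p` lies in no `G`-hole of
`(⋃ n, Fn n) ∪ K`. -/
theorem not_isGHole_iUnion_union (hG : IsOpen G)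
    (hFclosed : ∀ n, closure (Fn n) ∩ G ⊆ Fn n)
    (hdisj : Pairwise fun m n => Disjoint (Fn m) (Fn n))
    (hlocfin : ∀ z ∈ G, ∃ U ∈ nhds z, {n : ℕ | (Fn n ∩ U).Nonempty}.Finite)
    {K : Set ℂ} (hK : IsCompact K) (hKc : IsPreconnected K)
    {p : ℂ} (hpK : HasContinuousLog p K)
    (hlog : ∀ n, ∀ C ⊆ G, C ⊆ Fn n → IsCompact C → HasContinuousLog p (C ∪ K))
    {h : Set ℂ} (hp : p ∈ h) : ¬ IsGHole G ((⋃ n, Fn n) ∪ K) h := by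
  intro hh
  have hclosed : closure ((⋃ n, Fn n) ∪ K) ∩ G ⊆ (⋃ n, Fn n) ∪ K := by
    rw [closure_union, hK.isClosed.closure_eq, union_inter_distrib_right]
    exact union_subset_union (closure_iUnion_inter_subset hFclosed hlocfin) inter_subset_left
  have hfr := hh.frontier_subset hG hclosed
  obtain ⟨-, L, hL, hLG, hhL⟩ := hh
  have hfrL : frontier h ⊆ L :=
    frontier_subset_closure.trans (closure_minimal hhL hL.isClosed)
  have hfrc : IsCompact (frontier h) := hL.of_isClosed_subset isClosed_frontier hfrL
  have hEc : ∀ n, IsCompact (frontier h ∩ Fn n) := fun n =>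
    hfrc.inter_of_closure_inter_subset (hfrL.trans hLG) (hFclosed n)
  have hfin := finite_inter_nonempty_of_isCompact hlocfin hfrc (hfrL.trans hLG)
  have hglue := HasContinuousLog.biUnion_union hK.isClosed hKc (fun n => (hEc n).isClosed)
    (fun m n hmn => (hdisj hmn).mono inter_subset_right inter_subset_right) hpK
    (fun n => hlog n _ (inter_subset_left.trans (hfrL.trans hLG)) inter_subset_right (hEc n))
    hfin.toFinset
  refine HasContinuousLog.not_frontier (hL.isBounded.subset hhL) hp (hglue.mono fun z hz => ?_)
  rcases hfr hz with hzF | hzK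
  · obtain ⟨n, hn⟩ := mem_iUnion.1 hzF
    exact Or.inl (mem_iUnion₂.2 ⟨n, hfin.mem_toFinset.2 ⟨z, hn, hz⟩, hz, hn⟩)
  · exact Or.inr hzK

end LocallyFinite


/-- In a simply connected domain `G ⊆ ℂ`, the union of a locally finite
family of pairwise disjoint Arakeljan sets in `G` is again an Arakeljan set in `G`. -/
theorem isArakeljan_iUnion_of_simplyConnected
    (G : Set ℂ) (hGopen : IsOpen G) (hGconn : IsConnected G)
    (hGsc : SimplyConnectedSpace ↥G)
    (Fn : ℕ → Set ℂ)
    (hFG : ∀ n, Fn n ⊆ G) (hFclosed : ∀ n, closure (Fn n) ∩ G ⊆ Fn n)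
    (hdisj : Pairwise fun m n => Disjoint (Fn m) (Fn n))
    (hlocfin : ∀ z ∈ G, ∃ U ∈ nhds z, {n : ℕ | (Fn n ∩ U).Nonempty}.Finite)
    (hA : ∀ n, IsArakeljan G (Fn n)) :
    IsArakeljan G (⋃ n, Fn n) := by
  have hlogF : ∀ p ∈ G, p ∉ ⋃ n, Fn n → ∀ n, ∀ C ⊆ G, C ⊆ Fn n → IsCompact C →
      HasContinuousLog p C := fun p hpG hpF n C hCG hCF hC =>
    HasContinuousLog.of_not_isGHole hGopen hGsc hC hCF hCG
      ⟨hpG, fun h => hpF (mem_iUnion.2 ⟨n, h⟩)⟩ ((hA n).1 _)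
  refine ⟨fun g hg => ?_, fun K hK hKconn hKG hKJ => ?_⟩
  · obtain ⟨⟨p, hp, hgp⟩, -⟩ := id hg
    rw [← union_empty (⋃ n, Fn n)] at hg
    refine not_isGHole_iUnion_union hGopen hFclosed hdisj hlocfin isCompact_empty
      isPreconnected_empty HasContinuousLog.empty (fun n C hCG hCF hC => ?_)
      (hgp ▸ mem_connectedComponentIn hp) hg
    rw [union_empty]
    exact hlogF p hp.1 hp.2 n C hCG hCF hC
  · have hfin := finite_inter_nonempty_of_isCompact hlocfin hK hKG
    choose L hL hLG hLhole using fun n => (hA n).2 K hK hKconn hKG hKJ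
    obtain ⟨L₀, hL₀, hL₀G, hL₀log⟩ := HasContinuousLog.exists_isCompact hGopen hGsc hK hKG
    refine ⟨(⋃ n ∈ {n : ℕ | (Fn n ∩ K).Nonempty}, L n) ∪ L₀,
      (hfin.isCompact_biUnion fun n _ => hL n).union hL₀,
      union_subset (iUnion₂_subset fun n _ => hLG n) hL₀G, iUnion₂_subset fun h hh p hp => ?_⟩
    by_contra hpL
    rw [mem_union, not_or] at hpL
    obtain ⟨hpLn, hpL₀⟩ := hpL
    have hp' : p ∈ G \ ((⋃ n, Fn n) ∪ K) := by
      obtain ⟨⟨q, -, hq⟩, -⟩ := id hh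
      exact connectedComponentIn_subset _ _ (hq ▸ hp)
    have hpF : p ∉ ⋃ n, Fn n := fun h => hp'.2 (Or.inl h)
    refine not_isGHole_iUnion_union hGopen hFclosed hdisj hlocfin hK hKconn.isPreconnected
      (hL₀log p hpL₀) (fun n C hCG hCF hC => ?_) hp hh
    by_cases hn : (Fn n ∩ K).Nonempty
    · have hpn : p ∈ G \ (Fn n ∪ K) :=
        ⟨hp'.1, fun h => hp'.2 (h.imp_left fun h => mem_iUnion.2 ⟨n, h⟩)⟩
      refine HasContinuousLog.of_not_isGHole hGopen hGsc (hC.union hK)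
        (union_subset_union_left _ hCF) (union_subset hCG hKG) hpn fun hhole => ?_
      exact hpLn (mem_iUnion₂.2 ⟨n, hn,
        hLhole n (mem_iUnion₂.2 ⟨_, hhole, mem_connectedComponentIn hpn⟩)⟩)
    · refine (hlogF p hp'.1 hpF n C hCG hCF hC).union hC.isClosed hK.isClosed ?_ (hL₀log p hpL₀)
      rw [not_nonempty_iff_eq_empty] at hn
      rw [subset_eq_empty (inter_subset_inter_left K hCF) hn]
      exact isPreconnected_empty
end
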